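/- There exists a constant ε > 0 with the following property. Let H ∈ C^∞(S^1 × T*ℝ^n) be admissible, and let J = (J_t)_{t∈S^1} be a smooth S^1-family of almost complex structures on T*ℝ^n such that each J_t is compatible with ω_n and sup_{t∈S^1} ‖J_t − J_std‖_{C^0} < ε. Then for any x_−, x_+ ∈ 𝒫(H), the set ℳ_{H,J}(x_−, x_+) of smooth solutions u : ℝ × S^1 → T*ℝ^n of the Floer equation ∂_s u − J_t(u)(∂_t u − X_{H_t}(u)) = 0 with lim_{s→±∞} u(s,·) = x_± uniformly is C^0-bounded: there exists R > 0 with sup_{(s,t)} |u(s,t)| ≤ R for all u ∈ ℳ_{H,J}(x_−, x_+). -/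

import Mathlib

/-!
Statement 0: C⁰-bound for Floer trajectories of an admissible Hamiltonian on `T*ℝⁿ`,
for almost complex structures C⁰-close to the standard one (Lemma 2.2 of the paper).
-/

open scoped RealInnerProductSpace
open Filter

noncomputable section

/-- `ℝⁿ` with the Euclidean norm. -/
abbrev E (n : ℕ) : Type := EuclideanSpace ℝ (Fin n)

/-- `T*ℝⁿ = ℝⁿ × ℝⁿ`, with coordinates `(q, p)`. -/
abbrev P (n : ℕ) : Type := E n × E n

/-- The standard symplectic form `ω_n = Σ dp_i ∧ dq_i` on `T*ℝⁿ`. -/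
def omegaN {n : ℕ} (ξ η : P n) : ℝ := ⟪ξ.2, η.1⟫ - ⟪ξ.1, η.2⟫

/-- The Hamiltonian vector field `X_K(q,p) = (∂_p K(q,p), −∂_q K(q,p))`. -/
def XH {n : ℕ} (K : P n → ℝ) (z : P n) : P n :=
  (gradient (fun p => K (z.1, p)) z.2, -gradient (fun q => K (q, z.2)) z.1)

/-- The quadratic Hamiltonian `Q^a(q,p) = a(|q|² + |p|²)`. -/
def Qa {n : ℕ} (a : ℝ) (z : P n) : ℝ := a * (‖z.1‖ ^ 2 + ‖z.2‖ ^ 2)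

/-- The standard complex structure `J_std(ξ_q, ξ_p) = (ξ_p, −ξ_q)`. -/
def Jstd (n : ℕ) : P n →L[ℝ] P n :=
  (ContinuousLinearMap.snd ℝ (E n) (E n)).prod (-(ContinuousLinearMap.fst ℝ (E n) (E n)))

/-- A linear endomorphism of `T*ℝⁿ` is compatible with `ω_n` if
`(ξ, η) ↦ ω_n(ξ, Jη)` is an inner product (symmetric and positive definite). -/
def Compatible {n : ℕ} (Jz : P n →L[ℝ] P n) : Prop :=
  (∀ ξ η : P n, omegaN ξ (Jz η) = omegaN η (Jz ξ)) ∧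
  (∀ ξ : P n, ξ ≠ 0 → 0 < omegaN ξ (Jz ξ))

/-- `x ∈ 𝒫(H)`: a smooth 1-periodic orbit of the 1-periodic Hamiltonian `H`. -/
structure IsPeriodicOrbit {n : ℕ} (H : ℝ → P n → ℝ) (x : ℝ → P n) : Prop where
  smooth : ContDiff ℝ (⊤ : ℕ∞) x
  periodic : ∀ t, x (t + 1) = x t
  eqn : ∀ t, deriv x t = XH (H t) (x t)

/-- Nondegeneracy of a periodic orbit: `1` is not an eigenvalue of the linearized
time-one flow, i.e. the linearized equation along the orbit has no nonzero
1-periodic solution. -/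
def Nondeg {n : ℕ} (H : ℝ → P n → ℝ) (x : ℝ → P n) : Prop :=
  ∀ ξ : ℝ → P n, ContDiff ℝ (⊤ : ℕ∞) ξ → (∀ t, ξ (t + 1) = ξ t) →
    (∀ t, deriv ξ t = fderiv ℝ (XH (H t)) (x t) (ξ t)) → ξ = 0

/-- An admissible Hamiltonian: smooth, 1-periodic in time, satisfying (H0) and (H1). -/
structure Admissible {n : ℕ} (H : ℝ → P n → ℝ) : Prop where
  smooth : ContDiff ℝ (⊤ : ℕ∞) (fun z : ℝ × P n => H z.1 z.2)
  periodic : ∀ t z, H (t + 1) z = H t z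
  /-- (H0): every 1-periodic orbit is nondegenerate. -/
  h0 : ∀ x : ℝ → P n, IsPeriodicOrbit H x → Nondeg H x
  /-- (H1): `∃ a ∈ (0,∞) \ πℤ` with `sup_t ‖H_t − Q^a‖_{C¹} < ∞`. -/
  h1 : ∃ a : ℝ, 0 < a ∧ (∀ k : ℤ, a ≠ (k : ℝ) * Real.pi) ∧
      ∃ C : ℝ, ∀ t z, |H t z - Qa a z| ≤ C ∧
        ‖fderiv ℝ (fun w => H t w - Qa a w) z‖ ≤ C

/-- An element of the Floer moduli space `ℳ_{H,J}(x₋, x₊)`: a smooth solution of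
`∂_s u − J_t(u)(∂_t u − X_{H_t}(u)) = 0`, 1-periodic in `t`, converging uniformly
to `x₋` as `s → −∞` and to `x₊` as `s → +∞`. -/
structure FloerSol {n : ℕ} (H : ℝ → P n → ℝ) (J : ℝ → P n → P n →L[ℝ] P n)
    (xm xp : ℝ → P n) (u : ℝ → ℝ → P n) : Prop where
  smooth : ContDiff ℝ (⊤ : ℕ∞) (fun z : ℝ × ℝ => u z.1 z.2)
  periodic : ∀ s t, u s (t + 1) = u s t
  eqn : ∀ s t, deriv (fun s' => u s' t) s =
      J t (u s t) (deriv (fun t' => u s t') t - XH (H t) (u s t))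
  tendsto_bot : TendstoUniformly (fun s t => u s t) xm atBot
  tendsto_top : TendstoUniformly (fun s t => u s t) xp atTop

section CZeroBound

open MeasureTheory intervalIntegral Set Topology

section IntervalIntegrals

/-- Differentiation under the integral sign for jointly continuous integrands. -/
theorem hasDerivAt_intervalIntegral_of_continuous {V : Type*} [NormedAddCommGroup V]
    [NormedSpace ℝ V] {F F' : ℝ → ℝ → V}
    (hF : Continuous F.uncurry) (hF' : Continuous F'.uncurry)
    (h : ∀ x t, HasDerivAt (fun y => F y t) (F' x t) x) (a b x₀ : ℝ) :
    HasDerivAt (fun x => ∫ t in a..b, F x t) (∫ t in a..b, F' x₀ t) x₀ := by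
  have hcF : ∀ x, Continuous (F x) := fun x => hF.comp (Continuous.prodMk_right x)
  have hcF' : ∀ x, Continuous (F' x) := fun x => hF'.comp (Continuous.prodMk_right x)
  obtain ⟨C, hC⟩ := ((isCompact_closedBall x₀ 1).prod
    (isCompact_uIcc (a := a) (b := b))).exists_bound_of_continuousOn hF'.continuousOn
  refine (intervalIntegral.hasDerivAt_integral_of_dominated_loc_of_deriv_le (bound := fun _ => C)
    (F' := F') (Metric.closedBall_mem_nhds x₀ one_pos) ?_ ?_ ?_ ?_ ?_ ?_).2
  · exact Eventually.of_forall fun x => (hcF x).aestronglyMeasurable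
  · exact (hcF x₀).intervalIntegrable a b
  · exact (hcF' x₀).aestronglyMeasurable
  · exact Eventually.of_forall fun t ht x hx => hC (x, t) ⟨hx, uIoc_subset_uIcc ht⟩
  · exact intervalIntegrable_const
  · exact Eventually.of_forall fun t _ x _ => h x t

/-- Cauchy–Schwarz against the constant function. -/
theorem sq_intervalIntegral_le {f : ℝ → ℝ} (hf : Continuous f) {a b : ℝ} (hab : a < b) :
    (∫ t in a..b, f t) ^ 2 ≤ (b - a) * ∫ t in a..b, f t ^ 2 := by
  set I := ∫ t in a..b, f t
  have hba : 0 < b - a := sub_pos.2 hab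
  have h0 : 0 ≤ ∫ t in a..b, (f t - I / (b - a)) ^ 2 :=
    integral_nonneg hab.le fun t _ => sq_nonneg _
  have h1 : ∫ t in a..b, (f t - I / (b - a)) ^ 2
      = (∫ t in a..b, f t ^ 2) - I ^ 2 / (b - a) := by
    have : ∀ t, (f t - I / (b - a)) ^ 2
        = f t ^ 2 - 2 * (I / (b - a)) * f t + (I / (b - a)) ^ 2 := fun t => by ring
    simp only [this]
    rw [integral_add (Continuous.intervalIntegrable (by fun_prop) _ _)
        (Continuous.intervalIntegrable (by fun_prop) _ _),
      integral_sub (Continuous.intervalIntegrable (by fun_prop) _ _)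
        (Continuous.intervalIntegrable (by fun_prop) _ _),
      intervalIntegral.integral_const_mul, intervalIntegral.integral_const, smul_eq_mul]
    change _ - _ * I + _ = _
    field_simp
    ring
  rw [h1, sub_nonneg, div_le_iff₀ hba] at h0
  linarith

/-- The integral over a period of the derivative of a periodic function vanishes. -/
theorem intervalIntegral_deriv_eq_zero_of_eq {f f' : ℝ → ℝ} (hf : ∀ t, HasDerivAt f (f' t) t)
    (hf' : Continuous f') {a b : ℝ} (hab : f a = f b) : ∫ t in a..b, f' t = 0 := by
  rw [integral_eq_sub_of_hasDerivAt (fun t _ => hf t) (hf'.intervalIntegrable a b), hab, sub_self]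

end IntervalIntegrals

section Partials

variable {V : Type*} [NormedAddCommGroup V] [NormedSpace ℝ V]

/-- The partial derivative in the first variable. -/
def pdFst (U : ℝ × ℝ → V) (z : ℝ × ℝ) : V := fderiv ℝ U z (1, 0)

/-- The partial derivative in the second variable. -/
def pdSnd (U : ℝ × ℝ → V) (z : ℝ × ℝ) : V := fderiv ℝ U z (0, 1)

variable {U : ℝ × ℝ → V} (hU : ContDiff ℝ (⊤ : ℕ∞) U)
include hU

theorem hasFDerivAt_of_smooth (z : ℝ × ℝ) : HasFDerivAt U (fderiv ℝ U z) z :=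
  (hU.differentiable (by simp)).differentiableAt.hasFDerivAt

theorem contDiff_pdFst : ContDiff ℝ (⊤ : ℕ∞) (pdFst U) :=
  (hU.fderiv_right (m := (⊤ : ℕ∞)) (by simp)).clm_apply contDiff_const

theorem contDiff_pdSnd : ContDiff ℝ (⊤ : ℕ∞) (pdSnd U) :=
  (hU.fderiv_right (m := (⊤ : ℕ∞)) (by simp)).clm_apply contDiff_const

theorem hasDerivAt_pdFst (s t : ℝ) : HasDerivAt (fun x => U (x, t)) (pdFst U (s, t)) s :=
  (hasFDerivAt_of_smooth hU (s, t)).comp_hasDerivAt s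
    ((hasDerivAt_id s).prodMk (hasDerivAt_const s t))

theorem hasDerivAt_pdSnd (s t : ℝ) : HasDerivAt (fun x => U (s, x)) (pdSnd U (s, t)) t :=
  (hasFDerivAt_of_smooth hU (s, t)).comp_hasDerivAt t
    ((hasDerivAt_const t s).prodMk (hasDerivAt_id t))

theorem pdFst_pdSnd_comm (z : ℝ × ℝ) : pdFst (pdSnd U) z = pdSnd (pdFst U) z := by
  have hd : DifferentiableAt ℝ (fderiv ℝ U) z :=
    ((hU.fderiv_right (m := (⊤ : ℕ∞)) (by simp)).differentiable (by simp)).differentiableAt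
  have hs : IsSymmSndFDerivAt ℝ U z :=
    hU.contDiffAt.isSymmSndFDerivAt (by simpa using WithTop.coe_le_coe.2 (le_top : (2 : ℕ∞) ≤ ⊤))
  have key : ∀ e : ℝ × ℝ, ∀ f : ℝ × ℝ,
      fderiv ℝ (fun y => fderiv ℝ U y e) z f = fderiv ℝ (fderiv ℝ U) z f e := by
    intro e f
    rw [fderiv_clm_apply hd (differentiableAt_const e)]
    simp
  change fderiv ℝ (fun y => fderiv ℝ U y (0, 1)) z (1, 0)
    = fderiv ℝ (fun y => fderiv ℝ U y (1, 0)) z (0, 1)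
  rw [key, key]
  exact hs _ _

end Partials

section Area

variable {V : Type*} [NormedAddCommGroup V] [NormedSpace ℝ V] {ω : V →L[ℝ] V →L[ℝ] ℝ}

/-- First variation of the area enclosed by a loop. -/
theorem hasDerivAt_area (hω : ∀ ξ η, ω ξ η = -ω η ξ) {U : ℝ × ℝ → V}
    (hU : ContDiff ℝ (⊤ : ℕ∞) U) {a b : ℝ} (hper : ∀ s, U (s, a) = U (s, b)) (s : ℝ) :
    HasDerivAt (fun x => ∫ t in a..b, (1 / 2) * ω (U (x, t)) (pdSnd U (x, t)))
      (∫ t in a..b, ω (pdFst U (s, t)) (pdSnd U (s, t))) s := by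
  have c0 := hU.continuous
  have c1 := (contDiff_pdFst hU).continuous
  have c2 := (contDiff_pdSnd hU).continuous
  have c12 := (contDiff_pdSnd (contDiff_pdFst hU)).continuous
  have hperD : pdFst U (s, a) = pdFst U (s, b) := by
    rw [← (hasDerivAt_pdFst hU s a).deriv, ← (hasDerivAt_pdFst hU s b).deriv]
    simp only [hper]
  have hd := hasDerivAt_intervalIntegral_of_continuous
    (F := fun x t => (1 / 2) * ω (U (x, t)) (pdSnd U (x, t)))
    (F' := fun x t => (1 / 2) * (ω (pdFst U (x, t)) (pdSnd U (x, t))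
      + ω (U (x, t)) (pdSnd (pdFst U) (x, t))))
    (by simp only [Function.uncurry_def]; fun_prop)
    (by simp only [Function.uncurry_def]; fun_prop) (fun x t => by
      have h1 := (ω.hasFDerivAt.comp_hasDerivAt x (hasDerivAt_pdFst hU x t)).clm_apply
        (hasDerivAt_pdFst (contDiff_pdSnd hU) x t)
      rw [pdFst_pdSnd_comm hU] at h1
      exact h1.const_mul (1 / 2)) a b s
  have h0 : ∫ t in a..b, (1 / 2) * (ω (pdSnd U (s, t)) (pdFst U (s, t))
      + ω (U (s, t)) (pdSnd (pdFst U) (s, t))) = 0 := by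
    refine intervalIntegral_deriv_eq_zero_of_eq
      (f := fun t => (1 / 2) * ω (U (s, t)) (pdFst U (s, t))) (fun t => ?_) (by fun_prop) ?_
    · exact ((ω.hasFDerivAt.comp_hasDerivAt t (hasDerivAt_pdSnd hU s t)).clm_apply
        (hasDerivAt_pdSnd (contDiff_pdFst hU) s t)).const_mul (1 / 2)
    · simp only [hper, hperD]
  refine hd.congr_deriv ?_
  symm
  rw [← sub_zero (∫ t in a..b, (1 / 2) * (ω (pdFst U (s, t)) (pdSnd U (s, t))
      + ω (U (s, t)) (pdSnd (pdFst U) (s, t)))), ← h0,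
    ← integral_sub (Continuous.intervalIntegrable (by fun_prop) _ _)
      (Continuous.intervalIntegrable (by fun_prop) _ _)]
  refine integral_congr fun t _ => ?_
  rw [hω (pdSnd U (s, t))]
  ring

variable (hω : ∀ ξ η, ω ξ η = -ω η ξ)
include hω

/-- The difference of the areas enclosed by two loops. -/
theorem area_sub_area {x y x' y' : ℝ → V} (hx : ∀ t, HasDerivAt x (x' t) t)
    (hy : ∀ t, HasDerivAt y (y' t) t) (cx : Continuous x') (cy : Continuous y') {a b : ℝ}
    (px : x a = x b) (py : y a = y b) :
    (∫ t in a..b, (1 / 2) * ω (y t) (y' t)) - ∫ t in a..b, (1 / 2) * ω (x t) (x' t)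
      = ∫ t in a..b, (1 / 2) * ω (y t - x t) (y' t + x' t) := by
  have dx : Continuous x := continuous_iff_continuousAt.2 fun t => (hx t).continuousAt
  have dy : Continuous y := continuous_iff_continuousAt.2 fun t => (hy t).continuousAt
  have h0 : ∫ t in a..b, (1 / 2) * (ω (y' t) (x t) + ω (y t) (x' t)) = 0 :=
    intervalIntegral_deriv_eq_zero_of_eq (f := fun t => (1 / 2) * ω (y t) (x t))
      (fun t => ((ω.hasFDerivAt.comp_hasDerivAt t (hy t)).clm_apply (hx t)).const_mul (1 / 2))
      (by fun_prop) (by simp only [px, py])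
  rw [← integral_sub (Continuous.intervalIntegrable (by fun_prop) _ _)
      (Continuous.intervalIntegrable (by fun_prop) _ _), ← add_zero (∫ t in a..b, (_ - _)), ← h0,
    ← integral_add (Continuous.intervalIntegrable (by fun_prop) _ _)
      (Continuous.intervalIntegrable (by fun_prop) _ _)]
  refine integral_congr fun t _ => ?_
  simp only [map_sub, map_add, sub_apply]
  rw [hω (y' t) (x t)]
  ring

/-- The isoperimetric inequality, with a non-sharp constant. -/
theorem abs_area_le (hb : ∀ ξ η, |ω ξ η| ≤ 2 * ‖ξ‖ * ‖η‖) {x x' : ℝ → V}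
    (hx : ∀ t, HasDerivAt x (x' t) t) (cx : Continuous x') {a b : ℝ} (hab : a < b)
    (px : x a = x b) :
    |∫ t in a..b, (1 / 2) * ω (x t) (x' t)| ≤ (b - a) * ∫ t in a..b, ‖x' t‖ ^ 2 := by
  have dx : Continuous x := continuous_iff_continuousAt.2 fun t => (hx t).continuousAt
  have h := area_sub_area hω (fun t => hasDerivAt_const t (x a)) hx continuous_const cx rfl px
  simp only [map_zero, mul_zero, intervalIntegral.integral_zero, sub_zero, add_zero] at h
  rw [h]
  set L := ∫ t in a..b, ‖x' t‖
  have hL : ∀ t ∈ Icc a b, ‖x t - x a‖ ≤ L := by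
    intro t ht
    have h1 : ‖x t - x a‖ ≤ ∫ r in a..t, ‖x' r‖ := by
      refine norm_sub_le_integral_of_norm_deriv_le_of_le ht.1 dx.continuousOn
        (fun r _ => (hx r).differentiableAt.differentiableWithinAt) (B := fun r => ‖x' r‖)
        (Eventually.of_forall fun r _ => ?_) (Continuous.intervalIntegrable (by fun_prop) _ _)
      rw [(hx r).deriv]
    refine h1.trans (integral_mono_interval le_rfl ht.1 ht.2
      (Eventually.of_forall fun r => norm_nonneg _) (Continuous.intervalIntegrable (by fun_prop) _ _))
  calc |∫ t in a..b, (1 / 2) * ω (x t - x a) (x' t)|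
      ≤ ∫ t in a..b, |(1 / 2) * ω (x t - x a) (x' t)| := abs_integral_le_integral_abs hab.le
    _ ≤ ∫ t in a..b, L * ‖x' t‖ := by
        refine integral_mono_on hab.le (Continuous.intervalIntegrable (by fun_prop) _ _)
          (Continuous.intervalIntegrable (by fun_prop) _ _) fun t ht => ?_
        rw [abs_mul, abs_of_pos (by norm_num : (0 : ℝ) < 1 / 2)]
        have h2 := hb (x t - x a) (x' t)
        have h3 := mul_le_mul_of_nonneg_right (hL t ht) (norm_nonneg (x' t))
        linarith
    _ = L ^ 2 := by rw [intervalIntegral.integral_const_mul]; change L * L = _; ring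
    _ ≤ _ := sq_intervalIntegral_le (by fun_prop) hab

end Area

section LogPolar

open Real in
/-- Morrey-type estimate in logarithmic polar coordinates: for a solution of a perturbed
Cauchy–Riemann equation on a half cylinder which extends continuously by `p` at `-∞`, the
deviation of the mean over a circle from `p` is controlled by the energy on that circle. -/
theorem norm_circle_integral_sub_le {V : Type*} [NormedAddCommGroup V] [NormedSpace ℝ V]
    [CompleteSpace V]
    {ω : V →L[ℝ] V →L[ℝ] ℝ} (hω : ∀ ξ η, ω ξ η = -ω η ξ)
    (hb : ∀ ξ η, |ω ξ η| ≤ 2 * ‖ξ‖ * ‖η‖) {v : ℝ × ℝ → V} (hv : ContDiff ℝ (⊤ : ℕ∞) v)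
    (hper : ∀ τ, v (τ, -π) = v (τ, π)) {J : ℝ × ℝ → V →L[ℝ] V}
    (hJpos : ∀ z ξ, (1 / 2) * ‖ξ‖ ^ 2 ≤ ω ξ (J z ξ)) (hJ : ∀ z ξ, ‖J z ξ‖ ≤ 2 * ‖ξ‖)
    {M : ℝ} (hM : 0 ≤ M)
    (heq : ∀ τ θ, ‖pdFst v (τ, θ) - J (τ, θ) (pdSnd v (τ, θ))‖ ≤ M * exp τ)
    {τ₀ C₀ S : ℝ} {p : V}
    (hlim : ∀ τ ≤ τ₀, ∀ θ, ‖v (τ, θ) - p‖ ≤ C₀ * exp τ)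
    (hlim' : ∀ τ ≤ τ₀, ∀ θ, ‖pdSnd v (τ, θ)‖ ≤ C₀ * exp τ)
    (hS : 0 < S) (hMS : M * exp τ₀ ≤ S)
    (hyS : ∫ θ in (-π)..π, ‖pdSnd v (τ₀, θ)‖ ^ 2 ≤ S ^ 2) :
    ‖(∫ θ in (-π)..π, v (τ₀, θ)) - (2 * π) • p‖ ≤ 2 * π * (200 * S) := by
  have hπ := pi_pos
  have hπ' : -π < π := by linarith
  have hlen : π - -π = 2 * π := by ring
  have c0 := hv.continuous
  have c1 := (contDiff_pdFst hv).continuous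
  have c2 := (contDiff_pdSnd hv).continuous
  set y : ℝ → ℝ := fun τ => ∫ θ in (-π)..π, ‖pdSnd v (τ, θ)‖ ^ 2 with hy
  set b : ℝ → ℝ := fun τ => -∫ θ in (-π)..π, (1 / 2) * ω (v (τ, θ)) (pdSnd v (τ, θ)) with hbdef
  set b' : ℝ → ℝ := fun τ => -∫ θ in (-π)..π, ω (pdFst v (τ, θ)) (pdSnd v (τ, θ)) with hb_deriv
  have hbd : ∀ τ, HasDerivAt b (b' τ) τ := fun τ => (hasDerivAt_area hω hv hper τ).neg
  have habs : ∀ τ, |b τ| ≤ 2 * π * y τ := by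
    intro τ
    rw [hbdef, abs_neg, ← hlen]
    exact abs_area_le hω hb (fun t => hasDerivAt_pdSnd hv τ t) (by fun_prop) hπ' (hper τ)
  have hy0 : ∀ τ, 0 ≤ y τ := fun τ => integral_nonneg hπ'.le fun _ _ => by positivity
  -- differential inequality for the area
  have hb' : ∀ τ, y τ / 4 - 8 * π * M ^ 2 * exp τ ^ 2 ≤ b' τ := by
    intro τ
    have h1 : ∫ θ in (-π)..π, ((1 / 4) * ‖pdSnd v (τ, θ)‖ ^ 2 - 4 * (M * exp τ) ^ 2) ≤
        ∫ θ in (-π)..π, -ω (pdFst v (τ, θ)) (pdSnd v (τ, θ)) := by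
      refine integral_mono_on hπ'.le (Continuous.intervalIntegrable (by fun_prop) _ _)
        (Continuous.intervalIntegrable (by fun_prop) _ _) fun θ _ => ?_
      set ξ := pdSnd v (τ, θ)
      set k := pdFst v (τ, θ) - J (τ, θ) ξ with hk
      have hdec : pdFst v (τ, θ) = J (τ, θ) ξ + k := by rw [hk]; abel
      have e1 := hJpos (τ, θ) ξ
      have e2 := (abs_le.1 (hb k ξ)).2
      have e3 : ‖k‖ ≤ M * exp τ := heq τ θ
      have e4 : ‖k‖ * ‖ξ‖ ≤ (M * exp τ) * ‖ξ‖ := mul_le_mul_of_nonneg_right e3 (norm_nonneg _)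
      rw [hdec, map_add, add_apply, hω (J (τ, θ) ξ)]
      nlinarith [sq_nonneg (‖ξ‖ - 4 * (M * exp τ))]
    rw [integral_sub (Continuous.intervalIntegrable (by fun_prop) _ _)
      (Continuous.intervalIntegrable (by fun_prop) _ _), intervalIntegral.integral_const_mul,
      intervalIntegral.integral_const, intervalIntegral.integral_neg, hlen, smul_eq_mul] at h1
    change 1 / 4 * y τ - _ ≤ b' τ at h1
    linarith [h1]
  set β : ℝ := 1 / (16 * π) with hβ
  have hβ0 : 0 < β := by positivity
  have hβπ : β * π = 1 / 16 := by rw [hβ]; field_simp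
  have hβ1 : β ≤ 1 := by nlinarith [pi_gt_three]
  set lam : ℝ := S * exp (-β * τ₀) with hlam
  have hlam0 : 0 < lam := by positivity
  set G : ℝ → ℝ := fun τ => 2 * π * M * exp τ + 4 * π * lam / β * exp (β * τ)
    + 4 / lam * (exp (-β * τ) * b τ + 8 * π * M ^ 2 / (2 - β) * exp ((2 - β) * τ)) with hG
  set G' : ℝ → ℝ := fun τ => 2 * π * M * exp τ + 4 * π * lam / β * (exp (β * τ) * β)
    + 4 / lam * ((exp (-β * τ) * (-β) * b τ + exp (-β * τ) * b' τ)
      + 8 * π * M ^ 2 / (2 - β) * (exp ((2 - β) * τ) * (2 - β))) with hG'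
  have hexp : ∀ c τ : ℝ, HasDerivAt (fun x => exp (c * x)) (exp (c * τ) * c) τ := fun c τ => by
    simpa using ((hasDerivAt_id τ).const_mul c).exp
  have hGd : ∀ τ, HasDerivAt G (G' τ) τ := fun τ =>
    (((hasDerivAt_exp τ).const_mul _).add ((hexp β τ).const_mul _)).add
      ((((hexp (-β) τ).mul (hbd τ)).add ((hexp (2 - β) τ).const_mul _)).const_mul _)
  set m : ℝ → V := fun τ => ∫ θ in (-π)..π, v (τ, θ) with hm
  have hmd : ∀ τ, HasDerivAt m (∫ θ in (-π)..π, pdFst v (τ, θ)) τ := fun τ =>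
    hasDerivAt_intervalIntegral_of_continuous (F := fun x t => v (x, t))
      (F' := fun x t => pdFst v (x, t)) c0 c1 (fun x t => hasDerivAt_pdFst hv x t) _ _ τ
  have hmG : ∀ τ, ‖∫ θ in (-π)..π, pdFst v (τ, θ)‖ ≤ G' τ := by
    intro τ
    have e1 : ‖∫ θ in (-π)..π, pdFst v (τ, θ)‖ ≤
        ∫ θ in (-π)..π, (M * exp τ + 2 * (lam * exp (β * τ)) +
          1 / (2 * lam) * exp (-β * τ) * ‖pdSnd v (τ, θ)‖ ^ 2) := by
      refine norm_integral_le_of_norm_le hπ'.le (Eventually.of_forall fun θ _ => ?_)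
        (Continuous.intervalIntegrable (by fun_prop) _ _)
      set ξ := pdSnd v (τ, θ)
      have h1 : ‖pdFst v (τ, θ)‖ ≤ M * exp τ + 2 * ‖ξ‖ := by
        calc _ = ‖(pdFst v (τ, θ) - J (τ, θ) ξ) + J (τ, θ) ξ‖ := by rw [sub_add_cancel]
          _ ≤ _ := (norm_add_le _ _).trans (add_le_add (heq τ θ) (hJ _ _))
      have h2 : 2 * ‖ξ‖ ≤ 2 * (lam * exp (β * τ)) + 1 / (2 * lam) * exp (-β * τ) * ‖ξ‖ ^ 2 := by
        rw [neg_mul, Real.exp_neg]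
        set L := lam * exp (β * τ) with hL
        have hL0 : 0 < L := by positivity
        have : 1 / (2 * lam) * (exp (β * τ))⁻¹ * ‖ξ‖ ^ 2 = ‖ξ‖ ^ 2 / (2 * L) := by
          rw [hL]; field_simp
        rw [this, ← sub_le_iff_le_add', le_div_iff₀ (by positivity)]
        nlinarith [sq_nonneg (‖ξ‖ - 2 * L)]
      linarith
    rw [integral_add (Continuous.intervalIntegrable (by fun_prop) _ _)
      (Continuous.intervalIntegrable (by fun_prop) _ _), intervalIntegral.integral_const_mul,
      intervalIntegral.integral_const, hlen, smul_eq_mul] at e1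
    change _ ≤ _ + 1 / (2 * lam) * exp (-β * τ) * y τ at e1
    refine e1.trans ?_
    have e2 : y τ / 8 - 8 * π * M ^ 2 * exp τ ^ 2 ≤ b' τ - β * b τ := by
      have h3 := (abs_le.1 (habs τ)).2
      have h4 : β * b τ ≤ y τ / 8 := by
        calc β * b τ ≤ β * (2 * π * y τ) := mul_le_mul_of_nonneg_left h3 hβ0.le
          _ = 2 * (β * π) * y τ := by ring
          _ = y τ / 8 := by rw [hβπ]; ring
      linarith [hb' τ]
    have e3 : exp ((2 - β) * τ) = exp (-β * τ) * exp τ ^ 2 := by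
      rw [← Real.exp_nat_mul, ← Real.exp_add]; congr 1; push_cast; ring
    have h2β : (2 - β) ≠ 0 := by linarith
    have e4 : G' τ = 2 * π * (M * exp τ + 2 * (lam * exp (β * τ))) +
        4 / lam * exp (-β * τ) * (b' τ - β * b τ + 8 * π * M ^ 2 * exp τ ^ 2) := by
      simp only [hG', e3]
      field_simp
      ring
    rw [e4]
    have e5 : 1 / (2 * lam) * exp (-β * τ) * y τ = 4 / lam * exp (-β * τ) * (y τ / 8) := by
      field_simp
      ring
    rw [e5]
    have e6 : 0 ≤ 4 / lam * exp (-β * τ) := by positivity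
    have := mul_le_mul_of_nonneg_left
      (show y τ / 8 ≤ b' τ - β * b τ + 8 * π * M ^ 2 * exp τ ^ 2 by linarith) e6
    linarith
  -- value of the comparison function at the outer circle
  have hG0 : G τ₀ ≤ 2 * π * (200 * S) := by
    have x1 : lam * exp (β * τ₀) = S := by
      rw [hlam, mul_assoc, ← Real.exp_add]; simp
    have x2 : 4 / lam * exp (-β * τ₀) = 4 / S := by
      rw [hlam]; field_simp
    have x3 : exp ((2 - β) * τ₀) = exp (-β * τ₀) * exp τ₀ ^ 2 := by
      rw [← Real.exp_nat_mul, ← Real.exp_add]; congr 1; push_cast; ring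
    have x4 : G τ₀ = 2 * π * (M * exp τ₀) + 4 * π / β * S
        + 4 / S * (b τ₀ + 8 * π * (M * exp τ₀) ^ 2 / (2 - β)) := by
      rw [← x2, ← x1]
      simp only [hG, x3]
      ring
    have x5 : b τ₀ ≤ 2 * π * S ^ 2 :=
      (abs_le.1 (habs τ₀)).2.trans (mul_le_mul_of_nonneg_left hyS (by positivity))
    have x6 : (M * exp τ₀) ^ 2 ≤ S ^ 2 := pow_le_pow_left₀ (by positivity) hMS 2
    have x7 : 8 * π * (M * exp τ₀) ^ 2 / (2 - β) ≤ 8 * π * S ^ 2 := by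
      rw [div_le_iff₀ (by linarith)]
      have : 8 * π * (M * exp τ₀) ^ 2 ≤ 8 * π * S ^ 2 := by gcongr
      nlinarith [show 0 ≤ 8 * π * S ^ 2 by positivity]
    have x8 : 4 / S * (b τ₀ + 8 * π * (M * exp τ₀) ^ 2 / (2 - β)) ≤ 4 / S * (10 * π * S ^ 2) := by
      gcongr
      linarith
    have x9 : 4 / S * (10 * π * S ^ 2) = 40 * π * S := by field_simp; norm_num
    have x10 : 4 * π / β * S = 64 * π ^ 2 * S := by rw [hβ]; field_simp; norm_num
    rw [x4, x10]
    have x11 : 2 * π * (M * exp τ₀) ≤ 2 * π * S := by gcongr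
    have x12 : π * (π * S) ≤ 3.15 * (π * S) := by
      have := Real.pi_lt_d2
      gcongr
    have : 0 < π * S := by positivity
    nlinarith
  have hC₀ : 0 ≤ C₀ := by
    have := (norm_nonneg _).trans (hlim τ₀ le_rfl 0)
    exact nonneg_of_mul_nonneg_left this (exp_pos _)
  -- comparison on `[τ₁, τ₀]`
  set K : ℝ := 2 * π * C₀ + 4 / lam * (2 * π * (2 * π * C₀ ^ 2))
  have hcmp : ∀ τ₁ ≤ min 0 τ₀, ‖m τ₀ - (2 * π) • p‖ ≤ G τ₀ + K * exp τ₁ := by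
    intro τ₁ h₁
    have h₁0 : τ₁ ≤ 0 := h₁.trans (min_le_left _ _)
    have h₁τ : τ₁ ≤ τ₀ := h₁.trans (min_le_right _ _)
    have s1 : ‖m τ₀ - m τ₁‖ ≤ G τ₀ - G τ₁ := by
      refine image_norm_le_of_norm_deriv_right_le_deriv_boundary (f := fun τ => m τ - m τ₁)
        (B := fun τ => G τ - G τ₁) (a := τ₁) (b := τ₀) (B' := G')
        (fun τ _ => ((hmd τ).sub_const _).continuousAt.continuousWithinAt)
        (fun τ _ => ((hmd τ).sub_const _).hasDerivWithinAt) (by simp)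
        (fun τ => (hGd τ).sub_const _) (fun τ _ => hmG τ) (right_mem_Icc.2 h₁τ)
    have s2 : ‖m τ₁ - (2 * π) • p‖ ≤ 2 * π * C₀ * exp τ₁ := by
      have : m τ₁ - (2 * π) • p = ∫ θ in (-π)..π, (v (τ₁, θ) - p) := by
        rw [integral_sub (Continuous.intervalIntegrable (by fun_prop) _ _)
          (Continuous.intervalIntegrable (by fun_prop) _ _), intervalIntegral.integral_const, hlen]
      rw [this]
      have := norm_integral_le_of_norm_le_const (a := -π) (b := π)
        (f := fun θ => v (τ₁, θ) - p) (C := C₀ * exp τ₁) (fun θ _ => hlim τ₁ h₁τ θ)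
      rw [hlen, abs_of_pos (by positivity)] at this
      linarith
    have s3 : y τ₁ ≤ 2 * π * (C₀ ^ 2 * exp τ₁ ^ 2) := by
      have : y τ₁ ≤ ∫ θ in (-π)..π, (C₀ ^ 2 * exp τ₁ ^ 2) := by
        refine integral_mono_on hπ'.le (Continuous.intervalIntegrable (by fun_prop) _ _)
          (Continuous.intervalIntegrable (by fun_prop) _ _) fun θ _ => ?_
        rw [← mul_pow]
        exact pow_le_pow_left₀ (norm_nonneg _) (hlim' τ₁ h₁τ θ) 2
      rwa [intervalIntegral.integral_const, hlen, smul_eq_mul] at this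
    have s4 : -G τ₁ ≤ 4 / lam * (2 * π * (2 * π * C₀ ^ 2)) * exp τ₁ := by
      have t1 : 0 ≤ 2 * π * M * exp τ₁ + 4 * π * lam / β * exp (β * τ₁) := by positivity
      have t2 : 0 ≤ 8 * π * M ^ 2 / (2 - β) * exp ((2 - β) * τ₁) := by
        have : 0 < 2 - β := by linarith
        positivity
      have t3 : exp (-β * τ₁) * exp τ₁ ^ 2 ≤ exp τ₁ := by
        rw [← Real.exp_nat_mul, ← Real.exp_add]
        refine exp_le_exp.2 ?_
        push_cast
        nlinarith
      have t4 : exp (-β * τ₁) * -b τ₁ ≤ 2 * π * (2 * π * C₀ ^ 2) * exp τ₁ := by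
        calc exp (-β * τ₁) * -b τ₁
            ≤ exp (-β * τ₁) * (2 * π * (2 * π * (C₀ ^ 2 * exp τ₁ ^ 2))) := by
              have := (neg_le_abs (b τ₁)).trans (habs τ₁)
              gcongr
              refine this.trans ?_
              gcongr
          _ = 2 * π * (2 * π * C₀ ^ 2) * (exp (-β * τ₁) * exp τ₁ ^ 2) := by ring
          _ ≤ _ := by gcongr
      have t5 : 0 < 4 / lam := by positivity
      have t6 := mul_le_mul_of_nonneg_left t4 t5.le
      have t7 := mul_nonneg t5.le t2
      simp only [hG]
      linarith
    calc ‖m τ₀ - (2 * π) • p‖ = ‖(m τ₀ - m τ₁) + (m τ₁ - (2 * π) • p)‖ := by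
          rw [sub_add_sub_cancel]
      _ ≤ (G τ₀ - G τ₁) + 2 * π * C₀ * exp τ₁ := (norm_add_le _ _).trans (add_le_add s1 s2)
      _ ≤ _ := by
        simp only [K]
        linarith
  refine le_trans ?_ hG0
  have htend : Tendsto (fun τ₁ => G τ₀ + K * exp τ₁) atBot (𝓝 (G τ₀ + K * 0)) :=
    (tendsto_exp_atBot.const_mul K).const_add _
  rw [mul_zero, add_zero] at htend
  exact ge_of_tendsto htend ((eventually_le_atBot (min 0 τ₀)).mono hcmp)

end LogPolar

section GoodRadius

open Real

theorem setIntegral_prod_Icc_eq {G : ℝ × ℝ → ℝ} (hG : Continuous G) {a b c d : ℝ} (hab : a ≤ b)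
    (hcd : c ≤ d) :
    ∫ z in Icc a b ×ˢ Icc c d, G z = ∫ s in a..b, ∫ t in c..d, G (s, t) := by
  rw [Measure.volume_eq_prod, setIntegral_prod]
  · rw [integral_Icc_eq_integral_Ioc, ← integral_of_le hab]
    refine integral_congr fun s _ => ?_
    rw [integral_Icc_eq_integral_Ioc, ← integral_of_le hcd]
  · exact hG.continuousOn.integrableOn_compact (isCompact_Icc.prod isCompact_Icc)

/-- Integration in polar coordinates over an annulus contained in a square of side `2`. -/
theorem intervalIntegral_polar_le {G : ℝ × ℝ → ℝ} (hG : Continuous G) (h0 : ∀ z, 0 ≤ G z)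
    (s₀ t₀ : ℝ) {ρ : ℝ} (hρ : 0 < ρ) (hρ1 : 2 * ρ ≤ 1) :
    ∫ r in ρ..2 * ρ, r * ∫ θ in (-π)..π, G (s₀ + r * cos θ, t₀ + r * sin θ) ≤
      ∫ s in (s₀ - 1)..(s₀ + 1), ∫ t in (t₀ - 1)..(t₀ + 1), G (s, t) := by
  have hπ : -π ≤ π := by linarith [pi_pos]
  set A : Set (ℝ × ℝ) := {z | ρ ^ 2 ≤ z.1 ^ 2 + z.2 ^ 2 ∧ z.1 ^ 2 + z.2 ^ 2 ≤ (2 * ρ) ^ 2} with hA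
  have hAm : MeasurableSet A :=
    ((isClosed_le (f := fun _ : ℝ × ℝ => ρ ^ 2) (g := fun z => z.1 ^ 2 + z.2 ^ 2)
      (by fun_prop) (by fun_prop)).inter (isClosed_le (f := fun z : ℝ × ℝ => z.1 ^ 2 + z.2 ^ 2)
      (g := fun _ => (2 * ρ) ^ 2) (by fun_prop) (by fun_prop))).measurableSet
  set G₀ : ℝ × ℝ → ℝ := fun z => G (s₀ + z.1, t₀ + z.2) with hG₀
  have cG₀ : Continuous G₀ := by fun_prop
  have hpol := integral_comp_polarCoord_symm (A.indicator G₀)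
  have hR : ∫ z, A.indicator G₀ z ≤
      ∫ s in (s₀ - 1)..(s₀ + 1), ∫ t in (t₀ - 1)..(t₀ + 1), G (s, t) := by
    rw [MeasureTheory.integral_indicator hAm]
    calc ∫ z in A, G₀ z ≤ ∫ z in Icc (-1) 1 ×ˢ Icc (-1) 1, G₀ z := by
          refine setIntegral_mono_set
            (cG₀.continuousOn.integrableOn_compact (isCompact_Icc.prod isCompact_Icc))
            (Eventually.of_forall fun z => h0 _) (LE.le.eventuallyLE ?_)
          rintro ⟨x, y⟩ ⟨-, h⟩
          simp only at h
          simp only [mem_prod, mem_Icc]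
          refine ⟨abs_le.1 (abs_le_one_iff_mul_self_le_one.2 ?_),
            abs_le.1 (abs_le_one_iff_mul_self_le_one.2 ?_)⟩ <;>
            nlinarith [sq_nonneg x, sq_nonneg y]
      _ = ∫ s in (-1)..1, ∫ t in (-1)..1, G₀ (s, t) :=
          setIntegral_prod_Icc_eq cG₀ (by norm_num) (by norm_num)
      _ = _ := by
          have h1 : ∀ s, ∫ t in (-1)..1, G₀ (s, t)
              = ∫ t in (t₀ - 1)..(t₀ + 1), G (s₀ + s, t) := fun s => by
            simp only [hG₀]
            rw [integral_comp_add_left (fun t => G (s₀ + s, t)) t₀]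
            rfl
          simp only [h1]
          rw [integral_comp_add_left (fun s => ∫ t in (t₀ - 1)..(t₀ + 1), G (s, t)) s₀]
          rfl
  have hL : ∫ p in polarCoord.target, p.1 • A.indicator G₀ (polarCoord.symm p)
      = ∫ r in ρ..2 * ρ, r * ∫ θ in (-π)..π, G (s₀ + r * cos θ, t₀ + r * sin θ) := by
    set g : ℝ × ℝ → ℝ := fun p => p.1 * G (s₀ + p.1 * cos p.2, t₀ + p.1 * sin p.2) with hg
    have cg : Continuous g := by fun_prop
    have e1 : ∫ p in polarCoord.target, p.1 • A.indicator G₀ (polarCoord.symm p)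
        = ∫ p in polarCoord.target, (Icc ρ (2 * ρ) ×ˢ univ).indicator g p := by
      refine setIntegral_congr_fun (by
        rw [polarCoord_target]; exact measurableSet_Ioi.prod measurableSet_Ioo) ?_
      rintro ⟨r, θ⟩ hp
      rw [polarCoord_target] at hp
      have hr : 0 < r := hp.1
      have hn : (r * cos θ) ^ 2 + (r * sin θ) ^ 2 = r ^ 2 := by
        linear_combination r ^ 2 * Real.sin_sq_add_cos_sq θ
      have hmem : ((r * cos θ, r * sin θ) : ℝ × ℝ) ∈ A ↔
          ((r, θ) : ℝ × ℝ) ∈ Icc ρ (2 * ρ) ×ˢ (univ : Set ℝ) := by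
        simp only [hA, mem_ofPred_eq, hn, mem_prod, mem_Icc, mem_univ, and_true]
        rw [pow_le_pow_iff_left₀ hρ.le hr.le two_ne_zero,
          pow_le_pow_iff_left₀ hr.le (by linarith) two_ne_zero]
      simp only [polarCoord_symm_apply, smul_eq_mul, indicator, hmem]
      split_ifs <;> simp [hg, hG₀]
    rw [e1, setIntegral_indicator (measurableSet_Icc.prod MeasurableSet.univ), polarCoord_target,
      prod_inter_prod, inter_univ,
      inter_eq_right.2 (show Icc ρ (2 * ρ) ⊆ Ioi 0 from fun r hr => hρ.trans_le hr.1),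
      Measure.volume_eq_prod, setIntegral_prod]
    · rw [integral_Icc_eq_integral_Ioc, ← integral_of_le (by linarith)]
      refine integral_congr fun r _ => ?_
      simp only [hg]
      rw [← integral_Ioc_eq_integral_Ioo, ← integral_of_le hπ,
        intervalIntegral.integral_const_mul]
    · exact (cg.continuousOn.integrableOn_compact (isCompact_Icc.prod isCompact_Icc)).mono_set
        (prod_mono le_rfl Ioo_subset_Icc_self)
  rw [← hL, hpol]
  exact hR

/-- Courant–Lebesgue type selection of a good radius. -/
theorem exists_radius_integral_le {G : ℝ × ℝ → ℝ} (hG : Continuous G) (h0 : ∀ z, 0 ≤ G z)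
    {s₀ t₀ ρ D : ℝ} (hρ : 0 < ρ) (hρ1 : 2 * ρ ≤ 1)
    (hD : ∫ s in (s₀ - 1)..(s₀ + 1), ∫ t in (t₀ - 1)..(t₀ + 1), G (s, t) ≤ D) :
    ∃ r ∈ Icc ρ (2 * ρ),
      ρ * (r * ∫ θ in (-π)..π, G (s₀ + r * cos θ, t₀ + r * sin θ)) ≤ D := by
  by_contra! hcon
  set φ : ℝ → ℝ := fun r => r * ∫ θ in (-π)..π, G (s₀ + r * cos θ, t₀ + r * sin θ) with hφ
  have cφ : Continuous φ := by
    refine continuous_id.mul ?_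
    exact continuous_parametric_intervalIntegral_of_continuous'
      (f := fun r θ => G (s₀ + r * cos θ, t₀ + r * sin θ))
      (by simp only [Function.uncurry_def]; fun_prop) _ _
  have h1 : 0 < ∫ r in ρ..2 * ρ, (φ r - D / ρ) := by
    refine intervalIntegral_pos_of_pos_on (Continuous.intervalIntegrable (by fun_prop) _ _)
      (fun r hr => ?_) (by linarith)
    rw [sub_pos, div_lt_iff₀' hρ]
    exact hcon r (Ioo_subset_Icc_self hr)
  rw [integral_sub (cφ.intervalIntegrable _ _) (by simp), intervalIntegral.integral_const,
    smul_eq_mul, show (2 * ρ - ρ) * (D / ρ) = D by field_simp; ring] at h1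
  have := intervalIntegral_polar_le hG h0 s₀ t₀ hρ hρ1
  linarith

end GoodRadius

section PointwiseBound

open Real

theorem fderiv_apply_eq_pd {V : Type*} [NormedAddCommGroup V] [NormedSpace ℝ V]
    (U : ℝ × ℝ → V) (z : ℝ × ℝ) (a b : ℝ) :
    fderiv ℝ U z (a, b) = a • pdFst U z + b • pdSnd U z := by
  rw [pdFst, pdSnd, ← map_smul, ← map_smul, ← map_add]
  simp

theorem norm_exp_mul_le {τ a b : ℝ} (ha : |a| ≤ 1) (hb : |b| ≤ 1) :
    ‖((exp τ * a, exp τ * b) : ℝ × ℝ)‖ ≤ exp τ := by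
  refine norm_prod_le_iff.2 ⟨?_, ?_⟩ <;> rw [norm_eq_abs, abs_mul, abs_of_pos (exp_pos τ)]
  · exact mul_le_of_le_one_right (exp_pos τ).le ha
  · exact mul_le_of_le_one_right (exp_pos τ).le hb

/-- Pointwise bound for solutions of a perturbed Cauchy–Riemann equation in terms of the local
Sobolev energy and of the size of the perturbation. -/
theorem norm_le_of_local_energy {V : Type*} [NormedAddCommGroup V] [NormedSpace ℝ V]
    [CompleteSpace V]
    {ω : V →L[ℝ] V →L[ℝ] ℝ} (hω : ∀ ξ η, ω ξ η = -ω η ξ)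
    (hb : ∀ ξ η, |ω ξ η| ≤ 2 * ‖ξ‖ * ‖η‖) {u : ℝ × ℝ → V} (hu : ContDiff ℝ (⊤ : ℕ∞) u)
    {J : ℝ × ℝ → V →L[ℝ] V} (hJ2 : ∀ z ξ, J z (J z ξ) = -ξ)
    (hJpos : ∀ z ξ, (1 / 2) * ‖ξ‖ ^ 2 ≤ ω ξ (J z ξ)) (hJ : ∀ z ξ, ‖J z ξ‖ ≤ 2 * ‖ξ‖)
    {X : ℝ × ℝ → V} {N : ℝ} (hX : ∀ z, ‖X z‖ ≤ N)
    (heq : ∀ z, pdFst u z = J z (pdSnd u z - X z)) {s₀ t₀ ρ D : ℝ} (hρ : 0 < ρ)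
    (hρ1 : 2 * ρ ≤ 1)
    (hD : ∫ s in (s₀ - 1)..(s₀ + 1), ∫ t in (t₀ - 1)..(t₀ + 1),
      (‖u (s, t)‖ ^ 2 + ‖pdFst u (s, t)‖ ^ 2 + ‖pdSnd u (s, t)‖ ^ 2) ≤ D) :
    ‖u (s₀, t₀)‖ ≤ √D / ρ + 200 * (3 * √D + 6 * N * ρ + ρ) := by
  have hπ := pi_pos
  have hπ' : -π < π := by linarith
  have hlen : π - -π = 2 * π := by ring
  have hN : 0 ≤ N := (norm_nonneg _).trans (hX 0)
  have c0 := hu.continuous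
  have c1 := (contDiff_pdFst hu).continuous
  have c2 := (contDiff_pdSnd hu).continuous
  set G : ℝ × ℝ → ℝ := fun z => ‖u z‖ ^ 2 + ‖pdFst u z‖ ^ 2 + ‖pdSnd u z‖ ^ 2 with hG
  have cG : Continuous G := by fun_prop
  obtain ⟨r, ⟨hr1, hr2⟩, hr⟩ := exists_radius_integral_le cG (fun z => by positivity)
    (s₀ := s₀) (t₀ := t₀) hρ hρ1 hD
  have hr0 : 0 < r := hρ.trans_le hr1
  set I := ∫ θ in (-π)..π, G (s₀ + r * cos θ, t₀ + r * sin θ) with hI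
  have hI0 : 0 ≤ I := integral_nonneg hπ'.le fun θ _ => by positivity
  have hD0 : 0 ≤ D := le_trans (by positivity) hr
  set ζ : ℝ × ℝ → ℝ × ℝ := fun w => (s₀ + exp w.1 * cos w.2, t₀ + exp w.1 * sin w.2) with hζ
  set v : ℝ × ℝ → V := fun w => u (ζ w) with hv
  have hζs : ContDiff ℝ (⊤ : ℕ∞) ζ := by fun_prop
  have hvs : ContDiff ℝ (⊤ : ℕ∞) v := hu.comp hζs
  have hv1 : ∀ τ θ, pdFst v (τ, θ) = exp τ • (cos θ • pdFst u (ζ (τ, θ))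
      + sin θ • pdSnd u (ζ (τ, θ))) := by
    intro τ θ
    have h1 : HasDerivAt (fun x => ζ (x, θ)) (exp τ * cos θ, exp τ * sin θ) τ := by
      change HasDerivAt (fun x => ((s₀ + exp x * cos θ, t₀ + exp x * sin θ) : ℝ × ℝ)) _ τ
      exact (((hasDerivAt_exp τ).mul_const _).const_add _).prodMk
        (((hasDerivAt_exp τ).mul_const _).const_add _)
    have h2 := (hasFDerivAt_of_smooth hu (ζ (τ, θ))).comp_hasDerivAt τ h1
    rw [(hasDerivAt_pdFst hvs τ θ).unique h2, fderiv_apply_eq_pd, smul_add, smul_smul, smul_smul]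
  have hv2d : ∀ τ θ, pdSnd v (τ, θ)
      = fderiv ℝ u (ζ (τ, θ)) (exp τ * -sin θ, exp τ * cos θ) := by
    intro τ θ
    have h1 : HasDerivAt (fun x => ζ (τ, x)) (exp τ * -sin θ, exp τ * cos θ) θ := by
      change HasDerivAt (fun x => ((s₀ + exp τ * cos x, t₀ + exp τ * sin x) : ℝ × ℝ)) _ θ
      exact (((hasDerivAt_cos θ).const_mul _).const_add _).prodMk
        (((hasDerivAt_sin θ).const_mul _).const_add _)
    have h2 := (hasFDerivAt_of_smooth hu (ζ (τ, θ))).comp_hasDerivAt θ h1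
    exact (hasDerivAt_pdSnd hvs τ θ).unique h2
  have hv2 : ∀ τ θ, pdSnd v (τ, θ) = exp τ • (-sin θ • pdFst u (ζ (τ, θ))
      + cos θ • pdSnd u (ζ (τ, θ))) := by
    intro τ θ
    rw [hv2d, fderiv_apply_eq_pd, smul_add, smul_smul, smul_smul]
  have hM : 0 ≤ 3 * N := by positivity
  have hpert : ∀ τ θ, ‖pdFst v (τ, θ) - J (ζ (τ, θ)) (pdSnd v (τ, θ))‖ ≤ 3 * N * exp τ := by
    intro τ θ
    set z := ζ (τ, θ)
    have e1 : J z (pdFst u z) = -pdSnd u z + X z := by rw [heq, hJ2]; abel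
    have e2 : J z (pdSnd u z) = pdFst u z + J z (X z) := by rw [heq, map_sub]; abel
    have e3 : pdFst v (τ, θ) - J z (pdSnd v (τ, θ))
        = exp τ • (sin θ • X z - cos θ • J z (X z)) := by
      rw [hv1, hv2]
      change exp τ • (cos θ • pdFst u z + sin θ • pdSnd u z)
        - J z (exp τ • (-sin θ • pdFst u z + cos θ • pdSnd u z)) = _
      simp only [map_smul, map_add, e1, e2]
      module
    rw [e3, norm_smul, norm_eq_abs, abs_of_pos (exp_pos τ), mul_comm]
    gcongr
    calc ‖sin θ • X z - cos θ • J z (X z)‖ ≤ ‖sin θ • X z‖ + ‖cos θ • J z (X z)‖ :=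
          norm_sub_le _ _
      _ ≤ 1 * N + 1 * (2 * N) := by
        rw [norm_smul, norm_smul]
        gcongr
        · exact abs_sin_le_one θ
        · exact hX z
        · exact abs_cos_le_one θ
        · exact (hJ _ _).trans (by gcongr; exact hX z)
      _ = 3 * N := by ring
  have hper : ∀ τ, v (τ, -π) = v (τ, π) := fun τ => by simp [hv, hζ]
  obtain ⟨C₀, hC₀⟩ := (isCompact_closedBall (s₀, t₀) (1 : ℝ)).exists_bound_of_continuousOn
    (hu.continuous_fderiv (by simp)).continuousOn
  have hrexp : exp (log r) = r := exp_log hr0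
  have hball : ∀ τ ≤ log r, ∀ θ, ζ (τ, θ) ∈ Metric.closedBall (s₀, t₀) (1 : ℝ) ∧
      ‖ζ (τ, θ) - (s₀, t₀)‖ ≤ exp τ := by
    intro τ hτ θ
    have e1 : ζ (τ, θ) - (s₀, t₀) = (exp τ * cos θ, exp τ * sin θ) := by simp [hζ]
    have e2 : ‖ζ (τ, θ) - (s₀, t₀)‖ ≤ exp τ := by
      rw [e1]
      exact norm_exp_mul_le (abs_cos_le_one θ) (abs_sin_le_one θ)
    have e3 : exp τ ≤ 1 := by
      have := exp_le_exp.2 hτ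
      rw [hrexp] at this
      linarith
    exact ⟨mem_closedBall_iff_norm.2 (e2.trans e3), e2⟩
  have hC₀0 : 0 ≤ C₀ := (norm_nonneg _).trans (hC₀ _ (Metric.mem_closedBall_self zero_le_one))
  set S : ℝ := 3 * √D + 6 * N * ρ + ρ with hSdef
  have hS : 0 < S := by positivity
  have hMS : 3 * N * exp (log r) ≤ S := by
    rw [hrexp, hSdef]
    have : 3 * N * r ≤ 3 * N * (2 * ρ) := by gcongr
    linarith [sqrt_nonneg D]
  have hζr : ∀ θ, ζ (log r, θ) = (s₀ + r * cos θ, t₀ + r * sin θ) := fun θ => by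
    simp only [hζ, hrexp]
  have hrI : r * I ≤ D / ρ := by rwa [le_div_iff₀' hρ]
  have cv := hvs.continuous
  have cv2 := (contDiff_pdSnd hvs).continuous
  have hyS : ∫ θ in (-π)..π, ‖pdSnd v (log r, θ)‖ ^ 2 ≤ S ^ 2 := by
    calc ∫ θ in (-π)..π, ‖pdSnd v (log r, θ)‖ ^ 2
        ≤ ∫ θ in (-π)..π, 2 * r ^ 2 * G (s₀ + r * cos θ, t₀ + r * sin θ) := by
          refine integral_mono_on hπ'.le (Continuous.intervalIntegrable (by fun_prop) _ _)
            (Continuous.intervalIntegrable (by fun_prop) _ _) fun θ _ => ?_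
          rw [hv2, hrexp, hζr, norm_smul, norm_eq_abs, abs_of_pos hr0, mul_pow]
          set z : ℝ × ℝ := (s₀ + r * cos θ, t₀ + r * sin θ)
          have e1 : ‖-sin θ • pdFst u z + cos θ • pdSnd u z‖ ≤ ‖pdFst u z‖ + ‖pdSnd u z‖ := by
            refine (norm_add_le _ _).trans ?_
            rw [norm_smul, norm_smul]
            refine add_le_add (mul_le_of_le_one_left (norm_nonneg _) ?_)
              (mul_le_of_le_one_left (norm_nonneg _) (abs_cos_le_one θ))
            rw [norm_neg]
            exact abs_sin_le_one θ
          have e2 := pow_le_pow_left₀ (norm_nonneg _) e1 2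
          have e3 : ‖-sin θ • pdFst u z + cos θ • pdSnd u z‖ ^ 2 ≤ 2 * G z := by
            simp only [hG]
            nlinarith [sq_nonneg (‖pdFst u z‖ - ‖pdSnd u z‖), sq_nonneg ‖u z‖]
          have := mul_le_mul_of_nonneg_left e3 (sq_nonneg r)
          linarith
      _ = 2 * r * (r * I) := by rw [intervalIntegral.integral_const_mul]; ring
      _ ≤ 2 * (2 * ρ) * (D / ρ) := by gcongr
      _ = 4 * √D ^ 2 := by rw [sq_sqrt hD0]; field_simp; ring
      _ ≤ (3 * √D) ^ 2 := by nlinarith [sq_nonneg √D]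
      _ ≤ S ^ 2 := by
        have : 0 ≤ 6 * N * ρ + ρ := by positivity
        gcongr
        linarith
  have hmain := norm_circle_integral_sub_le hω hb hvs hper (J := fun w => J (ζ w))
    (fun w => hJpos _) (fun w => hJ _) hM hpert (τ₀ := log r) (C₀ := C₀) (S := S)
    (p := u (s₀, t₀)) (fun τ hτ θ => ?_) (fun τ hτ θ => ?_) hS hMS hyS
  · have hm : ‖∫ θ in (-π)..π, v (log r, θ)‖ ≤ 2 * π * (√D / ρ) := by
      have e1 : ‖∫ θ in (-π)..π, v (log r, θ)‖ ≤ ∫ θ in (-π)..π, ‖v (log r, θ)‖ :=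
        intervalIntegral.norm_integral_le_integral_norm hπ'.le
      refine e1.trans (abs_le_of_sq_le_sq' ?_ (by positivity)).2
      have e2 := sq_intervalIntegral_le (f := fun θ => ‖v (log r, θ)‖) (by fun_prop) hπ'
      rw [hlen] at e2
      have e3 : ∫ θ in (-π)..π, ‖v (log r, θ)‖ ^ 2 ≤ I := by
        refine integral_mono_on hπ'.le (Continuous.intervalIntegrable (by fun_prop) _ _)
          (Continuous.intervalIntegrable (by fun_prop) _ _) fun θ _ => ?_
        simp only [hv, hζr, hG]
        nlinarith [sq_nonneg ‖pdFst u (s₀ + r * cos θ, t₀ + r * sin θ)‖,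
          sq_nonneg ‖pdSnd u (s₀ + r * cos θ, t₀ + r * sin θ)‖]
      have e4 : I ≤ D / ρ ^ 2 := by
        rw [le_div_iff₀ (by positivity)]
        have : ρ * (ρ * I) ≤ ρ * (r * I) := by gcongr
        linarith
      calc _ ≤ 2 * π * (D / ρ ^ 2) := e2.trans (by gcongr; exact e3.trans e4)
        _ ≤ (2 * π) ^ 2 * (D / ρ ^ 2) := by
          gcongr
          nlinarith [pi_gt_three]
        _ = _ := by rw [mul_pow (2 * π) (√D / ρ), div_pow, sq_sqrt hD0]
    have h2π : ‖(2 * π) • u (s₀, t₀)‖ ≤ 2 * π * (√D / ρ) + 2 * π * (200 * S) := by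
      rw [norm_sub_rev] at hmain
      calc _ = ‖((2 * π) • u (s₀, t₀) - ∫ θ in (-π)..π, v (log r, θ))
            + ∫ θ in (-π)..π, v (log r, θ)‖ := by rw [sub_add_cancel]
        _ ≤ 2 * π * (200 * S) + 2 * π * (√D / ρ) := (norm_add_le _ _).trans (add_le_add hmain hm)
        _ = _ := add_comm _ _
    rw [norm_smul, norm_eq_abs, abs_of_pos (by positivity), ← mul_add] at h2π
    exact le_of_mul_le_mul_left h2π (by positivity)
  · obtain ⟨h1, h2⟩ := hball τ hτ θ
    have := (convex_closedBall (s₀, t₀) (1 : ℝ)).norm_image_sub_le_of_norm_fderiv_le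
      (𝕜 := ℝ) (fun z _ => (hasFDerivAt_of_smooth hu z).differentiableAt) hC₀
      (Metric.mem_closedBall_self zero_le_one) h1
    exact this.trans (by gcongr)
  · obtain ⟨h1, h2⟩ := hball τ hτ θ
    rw [hv2d]
    refine (ContinuousLinearMap.le_opNorm _ _).trans ?_
    gcongr
    · exact hC₀ _ h1
    · exact norm_exp_mul_le (by rw [abs_neg]; exact abs_sin_le_one θ) (abs_cos_le_one θ)

end PointwiseBound

section Symplectic

variable {n : ℕ}

/-- The standard symplectic form as a continuous bilinear map. -/
def omegaCL (n : ℕ) : P n →L[ℝ] P n →L[ℝ] ℝ :=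
  (innerSL ℝ).bilinearComp (ContinuousLinearMap.snd ℝ (E n) (E n))
      (ContinuousLinearMap.fst ℝ (E n) (E n))
    - (innerSL ℝ).bilinearComp (ContinuousLinearMap.fst ℝ (E n) (E n))
      (ContinuousLinearMap.snd ℝ (E n) (E n))

theorem omegaCL_apply (ξ η : P n) : omegaCL n ξ η = omegaN ξ η := rfl

theorem omegaCL_skew (ξ η : P n) : omegaCL n ξ η = -omegaCL n η ξ := by
  simp only [omegaCL_apply, omegaN, real_inner_comm]
  ring

theorem abs_omegaCL_le (ξ η : P n) : |omegaCL n ξ η| ≤ 2 * ‖ξ‖ * ‖η‖ := by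
  rw [omegaCL_apply, omegaN]
  have h1 := abs_real_inner_le_norm ξ.2 η.1
  have h2 := abs_real_inner_le_norm ξ.1 η.2
  have h3 := mul_le_mul (norm_snd_le ξ) (norm_fst_le η) (norm_nonneg _) (norm_nonneg _)
  have h4 := mul_le_mul (norm_fst_le ξ) (norm_snd_le η) (norm_nonneg _) (norm_nonneg _)
  linarith [abs_sub (⟪ξ.2, η.1⟫) (⟪ξ.1, η.2⟫)]

theorem Jstd_apply (ξ : P n) : Jstd n ξ = (ξ.2, -ξ.1) := rfl

theorem Jstd_Jstd (ξ : P n) : Jstd n (Jstd n ξ) = -ξ := rfl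

theorem norm_Jstd_le (ξ : P n) : ‖Jstd n ξ‖ ≤ ‖ξ‖ := by
  rw [Jstd_apply]
  exact norm_prod_le_iff.2 ⟨norm_snd_le ξ, by simpa using norm_fst_le ξ⟩

theorem sq_norm_le_omegaCL_Jstd (ξ : P n) : ‖ξ‖ ^ 2 ≤ omegaCL n ξ (Jstd n ξ) := by
  rw [omegaCL_apply, omegaN, Jstd_apply]
  simp only [inner_neg_right, real_inner_self_eq_norm_sq]
  rcases max_choice ‖ξ.1‖ ‖ξ.2‖ with h | h <;> rw [Prod.norm_def, h] <;>
    nlinarith [sq_nonneg ‖ξ.1‖, sq_nonneg ‖ξ.2‖]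

theorem half_sq_norm_le_omegaCL {A : P n →L[ℝ] P n} (hA : ‖A - Jstd n‖ ≤ 1 / 4) (ξ : P n) :
    (1 / 2) * ‖ξ‖ ^ 2 ≤ omegaCL n ξ (A ξ) := by
  have h1 := sq_norm_le_omegaCL_Jstd ξ
  have h2 := abs_omegaCL_le ξ ((A - Jstd n) ξ)
  have h3 := (A - Jstd n).le_of_opNorm_le hA ξ
  have h4 : omegaCL n ξ (A ξ) = omegaCL n ξ (Jstd n ξ) + omegaCL n ξ ((A - Jstd n) ξ) := by
    simp
  have h5 := mul_le_mul_of_nonneg_left h3 (by positivity : 0 ≤ 2 * ‖ξ‖)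
  nlinarith [neg_abs_le (omegaCL n ξ ((A - Jstd n) ξ))]

theorem norm_apply_le_of_near_Jstd {A : P n →L[ℝ] P n} (hA : ‖A - Jstd n‖ ≤ 1 / 4) (ξ : P n) :
    ‖A ξ‖ ≤ 2 * ‖ξ‖ := by
  have h1 := norm_Jstd_le ξ
  have h3 := (A - Jstd n).le_of_opNorm_le hA ξ
  have h4 : A ξ = Jstd n ξ + (A - Jstd n) ξ := by simp
  rw [h4]
  linarith [norm_add_le (Jstd n ξ) ((A - Jstd n) ξ), norm_nonneg ξ]

theorem fderiv_eq_omegaCL_XH {K : P n → ℝ} {z : P n} (hK : DifferentiableAt ℝ K z) (η : P n) :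
    fderiv ℝ K z η = omegaCL n η (XH K z) := by
  have h1 : HasFDerivAt (fun p => K (z.1, p))
      ((fderiv ℝ K z).comp (ContinuousLinearMap.inr ℝ (E n) (E n))) z.2 :=
    HasFDerivAt.comp z.2 (g := K) (f := fun p => (z.1, p)) hK.hasFDerivAt
      (hasFDerivAt_prodMk_right z.1 z.2)
  have h2 : HasFDerivAt (fun q => K (q, z.2))
      ((fderiv ℝ K z).comp (ContinuousLinearMap.inl ℝ (E n) (E n))) z.1 :=
    HasFDerivAt.comp z.1 (g := K) (f := fun q => (q, z.2)) hK.hasFDerivAt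
      (hasFDerivAt_prodMk_left z.1 z.2)
  have e1 : ⟪η.2, gradient (fun p => K (z.1, p)) z.2⟫ = fderiv ℝ K z (0, η.2) := by
    rw [real_inner_comm, gradient, InnerProductSpace.toDual_symm_apply, h1.fderiv]
    simp
  have e2 : ⟪η.1, gradient (fun q => K (q, z.2)) z.1⟫ = fderiv ℝ K z (η.1, 0) := by
    rw [real_inner_comm, gradient, InnerProductSpace.toDual_symm_apply, h2.fderiv]
    simp
  rw [omegaCL_apply, omegaN, XH]
  simp only [inner_neg_right]
  rw [e1, e2, sub_neg_eq_add, ← map_add]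
  simp

/-- A vector is controlled by its pairings under the symplectic form. -/
theorem norm_le_of_omegaCL_le {v : P n} {C : ℝ} (hC : 0 ≤ C)
    (h : ∀ η, omegaCL n η v ≤ C * ‖η‖) : ‖v‖ ≤ C := by
  by_contra hlt
  push Not at hlt
  have h1 := sq_norm_le_omegaCL_Jstd v
  have h2 := h (-Jstd n v)
  rw [norm_neg, map_neg, neg_apply, omegaCL_skew, neg_neg] at h2
  have h3 := mul_le_mul_of_nonneg_left (norm_Jstd_le v) hC
  nlinarith [norm_nonneg v]

theorem hasFDerivAt_Qa (a : ℝ) (z : P n) :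
    HasFDerivAt (Qa (n := n) a) ((omegaCL n).flip ((2 * a) • Jstd n z)) z := by
  have h1 : HasFDerivAt (fun w : P n => ‖w.1‖ ^ 2) _ z :=
    (hasFDerivAt_fst (𝕜 := ℝ) (p := z)).norm_sq
  have h2 : HasFDerivAt (fun w : P n => ‖w.2‖ ^ 2) _ z :=
    (hasFDerivAt_snd (𝕜 := ℝ) (p := z)).norm_sq
  refine ((h1.add h2).const_mul a).congr_fderiv ?_
  ext η <;>
  simp [omegaCL_apply, omegaN, Jstd_apply, real_inner_comm, inner_smul_right] <;> ring

theorem norm_XH_sub_le {K : P n → ℝ} (hK : Differentiable ℝ K) {a C : ℝ}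
    (h : ∀ z, ‖fderiv ℝ (fun w => K w - Qa a w) z‖ ≤ C) (z : P n) :
    ‖XH K z - (2 * a) • Jstd n z‖ ≤ C := by
  refine norm_le_of_omegaCL_le ((norm_nonneg _).trans (h z)) fun η => ?_
  have h1 := (hK z).hasFDerivAt.sub (hasFDerivAt_Qa a z)
  have h2 := (le_abs_self _).trans (((fderiv ℝ (fun w => K w - Qa a w) z).le_of_opNorm_le (h z) η))
  have h3 : fderiv ℝ (fun w => K w - Qa a w) z = _ := h1.fderiv
  rw [h3] at h2
  rw [map_sub, ← fderiv_eq_omegaCL_XH (hK z)]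
  exact h2

end Symplectic

section LoopEstimates

variable {n : ℕ}

theorem norm_le_of_rotation_sub {c s : ℝ} (hcs : c ^ 2 + s ^ 2 = 1) (hc : c < 1) (v : P n) :
    (2 / 3) * (1 - c) * ‖v‖ ≤ ‖c • v - s • Jstd n v - v‖ := by
  set w := c • v - s • Jstd n v - v with hw
  have h1 : (c - 1) • w + s • Jstd n w = (2 * (1 - c)) • v := by
    have e : Jstd n w = c • Jstd n v + s • v - Jstd n v := by
      simp only [hw, map_sub, map_smul, Jstd_Jstd]
      module
    have e2 : (2 * (1 - c)) = (c - 1) ^ 2 + s ^ 2 := by linarith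
    rw [e, e2, hw]
    module
  have h2 : ‖(2 * (1 - c)) • v‖ = 2 * (1 - c) * ‖v‖ := by
    rw [norm_smul, Real.norm_eq_abs, abs_of_pos (by linarith)]
  have hc1 : |c - 1| ≤ 2 := abs_le.2 ⟨by nlinarith [sq_nonneg s], by linarith⟩
  have hs1 : |s| ≤ 1 := abs_le_one_iff_mul_self_le_one.2 (by nlinarith [sq_nonneg c])
  have h3 : ‖(c - 1) • w + s • Jstd n w‖ ≤ 2 * ‖w‖ + 1 * ‖w‖ := by
    refine (norm_add_le _ _).trans ?_
    rw [norm_smul, norm_smul, Real.norm_eq_abs, Real.norm_eq_abs]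
    exact add_le_add (by gcongr) (mul_le_mul hs1 (norm_Jstd_le w) (norm_nonneg _) zero_le_one)
  rw [h1, h2] at h3
  linarith

/-- Nonresonance: `1`-periodic loops are controlled by `γ' - φ J γ` when `φ ∉ 2πℤ`. -/
theorem norm_loop_le_of_nonresonant {φ : ℝ} (hφ : Real.cos φ < 1) {γ γ' : ℝ → P n}
    (hγ : ∀ t, HasDerivAt γ (γ' t) t) (cγ' : Continuous γ') (hper : ∀ t, γ (t + 1) = γ t)
    (t₀ : ℝ) :
    (1 - Real.cos φ) * ‖γ t₀‖ ≤ 3 * ∫ t in (0 : ℝ)..1, ‖γ' t - φ • Jstd n (γ t)‖ := by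
  have cγ : Continuous γ := continuous_iff_continuousAt.2 fun t => (hγ t).continuousAt
  have hper' : ∀ t, γ' (t + 1) = γ' t := fun t => by
    have := (hγ (t + 1)).comp_add_const t 1
    simp only [hper] at this
    exact this.unique (hγ t)
  set η : ℝ → P n := fun t => Real.cos (φ * (t - t₀)) • γ t
    - Real.sin (φ * (t - t₀)) • Jstd n (γ t) with hη
  have dη : ∀ t, HasDerivAt η (Real.cos (φ * (t - t₀)) • (γ' t - φ • Jstd n (γ t))
      - Real.sin (φ * (t - t₀)) • Jstd n (γ' t - φ • Jstd n (γ t))) t := by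
    intro t
    have h0 : HasDerivAt (fun x : ℝ => φ * (x - t₀)) (φ * 1) t :=
      ((hasDerivAt_id t).sub_const t₀).const_mul φ
    have h1 := h0.cos.smul (hγ t)
    have h2 := h0.sin.smul ((Jstd n).hasFDerivAt.comp_hasDerivAt t (hγ t))
    refine (h1.sub h2).congr_deriv ?_
    simp only [map_sub, map_smul, Jstd_Jstd, mul_one, Function.comp_apply]
    module
  have h1 : ‖η (t₀ + 1) - η t₀‖ ≤ ∫ t in t₀..(t₀ + 1), 2 * ‖γ' t - φ • Jstd n (γ t)‖ := by
    refine norm_sub_le_integral_of_norm_deriv_le_of_le (by linarith)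
      (fun t _ => (dη t).continuousAt.continuousWithinAt)
      (fun t _ => (dη t).differentiableAt.differentiableWithinAt)
      (Eventually.of_forall fun t _ => ?_) (Continuous.intervalIntegrable (by fun_prop) _ _)
    rw [(dη t).deriv]
    set w := γ' t - φ • Jstd n (γ t)
    refine (norm_sub_le _ _).trans ?_
    rw [norm_smul, norm_smul, two_mul]
    refine add_le_add (mul_le_of_le_one_left (norm_nonneg _) (Real.abs_cos_le_one _)) ?_
    exact (mul_le_of_le_one_left (norm_nonneg _) (Real.abs_sin_le_one _)).trans (norm_Jstd_le w)
  have h2 : ∫ t in t₀..(t₀ + 1), ‖γ' t - φ • Jstd n (γ t)‖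
      = ∫ t in (0 : ℝ)..1, ‖γ' t - φ • Jstd n (γ t)‖ := by
    have hp : Function.Periodic (fun t => ‖γ' t - φ • Jstd n (γ t)‖) 1 := fun t => by
      simp only [hper, hper']
    simpa using hp.intervalIntegral_add_eq t₀ 0
  rw [intervalIntegral.integral_const_mul, h2] at h1
  have h3 : η (t₀ + 1) - η t₀ = Real.cos φ • γ t₀ - Real.sin φ • Jstd n (γ t₀) - γ t₀ := by
    simp [hη, hper]
  rw [h3] at h1
  have h4 := norm_le_of_rotation_sub (Real.cos_sq_add_sin_sq φ) hφ (γ t₀)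
  linarith

/-- Nonresonant loops are controlled in `C⁰` and `H¹` by the `L²` norm of the error term. -/
theorem exists_loop_bound {a : ℝ} (ha : Real.cos (2 * a) < 1) (C : ℝ) :
    ∃ M > (0 : ℝ), ∀ γ γ' ξ : ℝ → P n, (∀ t, HasDerivAt γ (γ' t) t) → Continuous γ' →
      Continuous ξ → (∀ t, γ (t + 1) = γ t) →
      (∀ t, ‖γ' t - (2 * a) • Jstd n (γ t)‖ ≤ 2 * ‖ξ t‖ + C) →
      ∫ t in (0 : ℝ)..1, (‖γ t‖ ^ 2 + ‖ξ t‖ ^ 2 + ‖γ' t‖ ^ 2)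
        ≤ M * (1 + ∫ t in (0 : ℝ)..1, ‖ξ t‖ ^ 2) := by
  set K := 3 / (1 - Real.cos (2 * a)) with hK
  have hd : 0 < 1 - Real.cos (2 * a) := by linarith
  have hK0 : 0 < K := by positivity
  refine ⟨(1 + 12 * a ^ 2) * K ^ 2 * (8 + 2 * C ^ 2) + 13 + 3 * C ^ 2, by positivity, ?_⟩
  intro γ γ' ξ hγ cγ' cξ hper hb
  have cγ : Continuous γ := continuous_iff_continuousAt.2 fun t => (hγ t).continuousAt
  set e := ∫ t in (0 : ℝ)..1, ‖ξ t‖ ^ 2 with he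
  have he0 : 0 ≤ e := integral_nonneg zero_le_one fun t _ => by positivity
  set I := ∫ t in (0 : ℝ)..1, ‖γ' t - (2 * a) • Jstd n (γ t)‖ with hI
  have hI0 : 0 ≤ I := integral_nonneg zero_le_one fun t _ => by positivity
  have hI2 : I ^ 2 ≤ 8 * e + 2 * C ^ 2 := by
    have h1 := sq_intervalIntegral_le (f := fun t => ‖γ' t - (2 * a) • Jstd n (γ t)‖)
      (by fun_prop) (zero_lt_one' ℝ)
    have h2 : ∫ t in (0 : ℝ)..1, ‖γ' t - (2 * a) • Jstd n (γ t)‖ ^ 2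
        ≤ ∫ t in (0 : ℝ)..1, (8 * ‖ξ t‖ ^ 2 + 2 * C ^ 2) := by
      refine integral_mono_on zero_le_one (Continuous.intervalIntegrable (by fun_prop) _ _)
        (Continuous.intervalIntegrable (by fun_prop) _ _) fun t _ => ?_
      have := pow_le_pow_left₀ (norm_nonneg _) (hb t) 2
      nlinarith [sq_nonneg (2 * ‖ξ t‖ - C)]
    rw [integral_add (Continuous.intervalIntegrable (by fun_prop) _ _)
      (Continuous.intervalIntegrable (by fun_prop) _ _),
      intervalIntegral.integral_const_mul, intervalIntegral.integral_const] at h2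
    simp only [sub_zero, one_mul, smul_eq_mul] at h1 h2
    exact h1.trans h2
  have hsup : ∀ t, ‖γ t‖ ^ 2 ≤ K ^ 2 * (8 * e + 2 * C ^ 2) := by
    intro t
    have h1 := norm_loop_le_of_nonresonant ha hγ cγ' hper t
    have h2 : ‖γ t‖ ≤ K * I := by
      rw [hK, div_mul_eq_mul_div, le_div_iff₀ hd]
      linarith
    calc ‖γ t‖ ^ 2 ≤ (K * I) ^ 2 := by gcongr
      _ = K ^ 2 * I ^ 2 := by ring
      _ ≤ _ := by gcongr
  set B := K ^ 2 * (8 * e + 2 * C ^ 2) with hB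
  calc ∫ t in (0 : ℝ)..1, (‖γ t‖ ^ 2 + ‖ξ t‖ ^ 2 + ‖γ' t‖ ^ 2)
      ≤ ∫ t in (0 : ℝ)..1, (((1 + 12 * a ^ 2) * B + 3 * C ^ 2) + 13 * ‖ξ t‖ ^ 2) := by
        refine integral_mono_on zero_le_one (Continuous.intervalIntegrable (by fun_prop) _ _)
          (Continuous.intervalIntegrable (by fun_prop) _ _) fun t _ => ?_
        have h1 : ‖γ' t‖ ≤ 2 * ‖ξ t‖ + C + 2 * |a| * ‖γ t‖ := by
          have h2 : ‖(2 * a) • Jstd n (γ t)‖ ≤ 2 * |a| * ‖γ t‖ := by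
            rw [norm_smul, Real.norm_eq_abs, abs_mul, abs_two]
            gcongr
            exact norm_Jstd_le _
          have h3 := norm_add_le (γ' t - (2 * a) • Jstd n (γ t)) ((2 * a) • Jstd n (γ t))
          rw [sub_add_cancel] at h3
          linarith [hb t]
        have h4 : ‖γ' t‖ ^ 2 ≤ 12 * ‖ξ t‖ ^ 2 + 3 * C ^ 2 + 12 * a ^ 2 * ‖γ t‖ ^ 2 := by
          have h5 := pow_le_pow_left₀ (norm_nonneg _) h1 2
          have h6 : (2 * |a| * ‖γ t‖) ^ 2 = 4 * a ^ 2 * ‖γ t‖ ^ 2 := by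
            rw [mul_pow, mul_pow, sq_abs]; ring
          nlinarith [sq_nonneg (2 * ‖ξ t‖ - C), sq_nonneg (2 * ‖ξ t‖ - 2 * |a| * ‖γ t‖),
            sq_nonneg (C - 2 * |a| * ‖γ t‖)]
        have h7 := mul_le_mul_of_nonneg_left (hsup t) (by positivity : 0 ≤ 1 + 12 * a ^ 2)
        linarith
    _ = (1 + 12 * a ^ 2) * B + 3 * C ^ 2 + 13 * e := by
        rw [integral_add (Continuous.intervalIntegrable (by fun_prop) _ _)
          (Continuous.intervalIntegrable (by fun_prop) _ _),
          intervalIntegral.integral_const_mul, intervalIntegral.integral_const]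
        simp [he]
    _ ≤ _ := by
        have h1 : 0 ≤ (1 + 12 * a ^ 2) * K ^ 2 := by positivity
        have h2 := mul_nonneg h1 (mul_nonneg (sq_nonneg C) he0)
        have h3 := mul_nonneg (sq_nonneg C) he0
        nlinarith

theorem cos_two_mul_lt_one {a : ℝ} (h : ∀ k : ℤ, a ≠ (k : ℝ) * Real.pi) :
    Real.cos (2 * a) < 1 := by
  refine lt_of_le_of_ne (Real.cos_le_one _) fun h1 => ?_
  obtain ⟨k, hk⟩ := (Real.cos_eq_one_iff _).1 h1
  exact h k (by linarith)

end LoopEstimates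

section GradientFlow

/-- A dissipative quantity lies above its asymptotic value when its distance to that value is
controlled by the square root of the dissipation rate. -/
theorem le_of_dissipative_atTop {f f' e : ℝ → ℝ} {L : ℝ} (hf : ∀ s, HasDerivAt f (f' s) s)
    (he : ∀ s, 0 ≤ e s) (hfe : ∀ s, f' s ≤ -(1 / 2) * e s)
    (hL : ∀ η > 0, ∀ᶠ s in atTop, |f s - L| ≤ η * (1 + √(e s))) (s₀ : ℝ) : L ≤ f s₀ := by
  by_contra hlt
  push Not at hlt
  have hanti : Antitone f := antitone_of_deriv_nonpos (fun s => (hf s).differentiableAt)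
    fun s => by rw [(hf s).deriv]; linarith [hfe s, he s]
  set g₀ := L - f s₀ with hg₀
  have hg₀p : 0 < g₀ := by linarith
  have hg : ∀ s ≥ s₀, g₀ ≤ L - f s := fun s hs => by linarith [hanti hs]
  set η := min (1 / 4) (g₀ / 2) with hη
  have hηp : 0 < η := by positivity
  obtain ⟨S, hS⟩ := eventually_atTop.1 ((hL η hηp).and (eventually_ge_atTop s₀))
  have hgpos : ∀ s ≥ S, 0 < L - f s := fun s hs => hg₀p.trans_le (hg s (hS s hs).2)
  have hquad : ∀ s ≥ S, (L - f s) ^ 2 ≤ -f' s := by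
    intro s hs
    have h1 := (hS s hs).1
    have h2 := hg s (hS s hs).2
    have h3 : L - f s ≤ η + η * √(e s) := by linarith [neg_abs_le (f s - L)]
    have h4 : η ≤ g₀ / 2 := min_le_right _ _
    have h5 : η ≤ 1 / 4 := min_le_left _ _
    have h6 : η * √(e s) ≤ 1 / 4 * √(e s) := by gcongr
    have h7 : L - f s ≤ 1 / 2 * √(e s) := by linarith
    have h8 := pow_le_pow_left₀ (hgpos s hs).le h7 2
    rw [mul_pow, Real.sq_sqrt (he s)] at h8
    linarith [hfe s, he s]
  have hd : ∀ s ≥ S, HasDerivAt (fun x => -(L - f x)⁻¹ - x) (-(f' s) / (L - f s) ^ 2 - 1) s := by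
    intro s hs
    have h1 := ((((hf s).const_sub L).inv (hgpos s hs).ne').neg).sub (hasDerivAt_id s)
    refine h1.congr_deriv ?_
    ring
  have hmono : MonotoneOn (fun x => -(L - f x)⁻¹ - x) (Ici S) := by
    refine monotoneOn_of_deriv_nonneg (convex_Ici S)
      (fun s hs => (hd s hs).continuousAt.continuousWithinAt)
      (fun s hs => (hd s (interior_subset hs)).differentiableAt.differentiableWithinAt)
      fun s hs => ?_
    have hs' : S ≤ s := interior_subset hs
    rw [(hd s hs').deriv, sub_nonneg, one_le_div (pow_pos (hgpos s hs') 2)]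
    exact hquad s hs'
  have hT : 0 < (L - f S)⁻¹ := inv_pos.2 (hgpos S le_rfl)
  have h1 := hmono (a := S) (b := S + (L - f S)⁻¹) self_mem_Ici
    (by simpa using hT.le) (by linarith)
  have h2 := inv_pos.2 (hgpos (S + (L - f S)⁻¹) (by linarith))
  simp only at h1
  linarith

/-- Energy identity: the total dissipation is bounded by the difference of asymptotic values. -/
theorem integral_dissipation_le {f f' e : ℝ → ℝ} {Lm Lp : ℝ} (hf : ∀ s, HasDerivAt f (f' s) s)
    (ce : Continuous e) (he : ∀ s, 0 ≤ e s) (hfe : ∀ s, f' s ≤ -(1 / 2) * e s)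
    (hLp : ∀ η > 0, ∀ᶠ s in atTop, |f s - Lp| ≤ η * (1 + √(e s)))
    (hLm : ∀ η > 0, ∀ᶠ s in atBot, |f s - Lm| ≤ η * (1 + √(e s))) {a b : ℝ} (hab : a ≤ b) :
    ∫ s in a..b, e s ≤ 2 * (Lm - Lp) := by
  have h1 := le_of_dissipative_atTop hf he hfe hLp b
  have h2 : -Lm ≤ -f (-(-a)) := by
    refine le_of_dissipative_atTop (f := fun s => -f (-s)) (f' := fun s => f' (-s))
      (e := fun s => e (-s)) (fun s => ?_) (fun s => he _) (fun s => hfe _) (fun η hη => ?_) (-a)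
    · exact (((hf (-s)).scomp s (hasDerivAt_neg s)).neg).congr_deriv (by simp)
    · filter_upwards [tendsto_neg_atTop_atBot.eventually (hLm η hη)] with s hs
      rwa [neg_sub_neg, abs_sub_comm]
  rw [neg_neg] at h2
  have h3 : AntitoneOn (fun s => f s + (1 / 2) * ∫ x in a..s, e x) (Icc a b) := by
    have hd : ∀ s, HasDerivAt (fun s => f s + (1 / 2) * ∫ x in a..s, e x)
        (f' s + (1 / 2) * e s) s := fun s =>
      (hf s).add ((ce.integral_hasStrictDerivAt a s).hasDerivAt.const_mul _)
    refine (antitone_of_deriv_nonpos (fun s => (hd s).differentiableAt) fun s => ?_).antitoneOn _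
    rw [(hd s).deriv]
    linarith [hfe s]
  have h4 := h3 (left_mem_Icc.2 hab) (right_mem_Icc.2 hab) hab
  simp only [intervalIntegral.integral_same, mul_zero, add_zero] at h4
  linarith

end GradientFlow

section Action

variable {n : ℕ} {H : ℝ → P n → ℝ}

theorem differentiable_of_smooth_uncurry
    (hH : ContDiff ℝ (⊤ : ℕ∞) (fun z : ℝ × P n => H z.1 z.2)) (t : ℝ) :
    Differentiable ℝ (H t) :=
  (hH.comp (contDiff_prodMk_right t)).differentiable (by simp)

/-- First variation of the symplectic action along a family of loops. -/
theorem hasDerivAt_action (hH : ContDiff ℝ (⊤ : ℕ∞) (fun z : ℝ × P n => H z.1 z.2))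
    {U : ℝ × ℝ → P n} (hU : ContDiff ℝ (⊤ : ℕ∞) U) {a b : ℝ}
    (hper : ∀ s, U (s, a) = U (s, b)) (s : ℝ) :
    HasDerivAt (fun x => (∫ t in a..b, (1 / 2) * omegaCL n (U (x, t)) (pdSnd U (x, t)))
        - ∫ t in a..b, H t (U (x, t)))
      (∫ t in a..b, omegaCL n (pdFst U (s, t)) (pdSnd U (s, t) - XH (H t) (U (s, t)))) s := by
  set W : ℝ × ℝ → ℝ := fun z => H z.2 (U z) with hW
  have hWs : ContDiff ℝ (⊤ : ℕ∞) W := hH.comp (contDiff_snd.prodMk hU)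
  have c1 := (contDiff_pdFst hU).continuous
  have c2 := (contDiff_pdSnd hU).continuous
  have cW := (contDiff_pdFst hWs).continuous
  have e1 : ∀ x t, pdFst W (x, t) = omegaCL n (pdFst U (x, t)) (XH (H t) (U (x, t))) := by
    intro x t
    have hd := differentiable_of_smooth_uncurry hH t (U (x, t))
    rw [← fderiv_eq_omegaCL_XH hd]
    refine (hasDerivAt_pdFst hWs x t).unique ?_
    change HasDerivAt (H t ∘ fun x => U (x, t)) _ x
    exact hd.hasFDerivAt.comp_hasDerivAt x (hasDerivAt_pdFst hU x t)
  have h2 := hasDerivAt_intervalIntegral_of_continuous (F := fun x t => W (x, t))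
    (F' := fun x t => pdFst W (x, t)) hWs.continuous cW (fun x t => hasDerivAt_pdFst hWs x t) a b s
  refine ((hasDerivAt_area omegaCL_skew hU hper s).sub h2).congr_deriv ?_
  rw [← integral_sub (Continuous.intervalIntegrable (by fun_prop) _ _)
    (Continuous.intervalIntegrable (by fun_prop) _ _)]
  simp only [e1, map_sub]

/-- Closeness of the actions of two nearby loops. -/
theorem abs_action_sub_le (hH : ContDiff ℝ (⊤ : ℕ∞) (fun z : ℝ × P n => H z.1 z.2)) {N : ℝ}
    (hN : ∀ t z, ‖XH (H t) z‖ ≤ N * (‖z‖ + 1)) {x x' y y' ξ : ℝ → P n}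
    (hx : ∀ t, HasDerivAt x (x' t) t) (hy : ∀ t, HasDerivAt y (y' t) t) (cx : Continuous x')
    (cy : Continuous y') (cξ : Continuous ξ) (px : x 0 = x 1) (py : y 0 = y 1) {R δ : ℝ}
    (hxN : ∀ t, ‖x' t‖ ≤ N * (‖x t‖ + 1)) (hyN : ∀ t, ‖y' t‖ ≤ 2 * ‖ξ t‖ + N * (‖y t‖ + 1))
    (hR : ∀ t ∈ Icc (0 : ℝ) 1, ‖x t‖ ≤ R) (hδ : ∀ t, ‖y t - x t‖ ≤ δ) (hδ1 : δ ≤ 1) :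
    |((∫ t in (0 : ℝ)..1, (1 / 2) * omegaCL n (y t) (y' t)) - ∫ t in (0 : ℝ)..1, H t (y t))
      - ((∫ t in (0 : ℝ)..1, (1 / 2) * omegaCL n (x t) (x' t)) - ∫ t in (0 : ℝ)..1, H t (x t))|
      ≤ δ * (2 * √(∫ t in (0 : ℝ)..1, ‖ξ t‖ ^ 2) + 4 * N * (R + 2)) := by
  have dx : Continuous x := continuous_iff_continuousAt.2 fun t => (hx t).continuousAt
  have dy : Continuous y := continuous_iff_continuousAt.2 fun t => (hy t).continuousAt
  have cHx : Continuous fun t => H t (x t) := hH.continuous.comp (continuous_id.prodMk dx)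
  have cHy : Continuous fun t => H t (y t) := hH.continuous.comp (continuous_id.prodMk dy)
  have hN0 : 0 ≤ N := by simpa using (norm_nonneg _).trans (hN 0 0)
  have hδ0 : 0 ≤ δ := (norm_nonneg _).trans (hδ 0)
  have hyR : ∀ t ∈ Icc (0 : ℝ) 1, ‖y t‖ ≤ R + 1 := fun t ht => by
    have := norm_add_le (y t - x t) (x t)
    rw [sub_add_cancel] at this
    linarith [hδ t, hR t ht]
  rw [sub_sub_sub_comm, area_sub_area omegaCL_skew hx hy cx cy px py,
    ← integral_sub (cHy.intervalIntegrable _ _) (cHx.intervalIntegrable _ _),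
    ← integral_sub (Continuous.intervalIntegrable (by fun_prop) _ _)
      (Continuous.intervalIntegrable (by fun_prop) _ _)]
  have hpt : ∀ t ∈ Icc (0 : ℝ) 1, |(1 / 2) * omegaCL n (y t - x t) (y' t + x' t)
      - (H t (y t) - H t (x t))| ≤ δ * (2 * ‖ξ t‖ + 4 * N * (R + 2)) := by
    intro t ht
    have h1 := abs_omegaCL_le (y t - x t) (y' t + x' t)
    have h2 : ‖y' t + x' t‖ ≤ 2 * ‖ξ t‖ + 2 * N * (R + 2) := by
      have h3 : N * (‖y t‖ + 1) ≤ N * (R + 2) :=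
        mul_le_mul_of_nonneg_left (by linarith [hyR t ht]) hN0
      have h4 : N * (‖x t‖ + 1) ≤ N * (R + 2) :=
        mul_le_mul_of_nonneg_left (by linarith [hR t ht]) hN0
      linarith [norm_add_le (y' t) (x' t), hxN t, hyN t]
    have h5 : ‖y t - x t‖ * ‖y' t + x' t‖ ≤ δ * (2 * ‖ξ t‖ + 2 * N * (R + 2)) :=
      mul_le_mul (hδ t) h2 (norm_nonneg _) hδ0
    have h6 : ‖H t (y t) - H t (x t)‖ ≤ 2 * (N * (R + 2)) * ‖y t - x t‖ := by
      have hR0 : 0 ≤ R := (norm_nonneg _).trans (hR t ht)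
      refine (convex_closedBall (0 : P n) (R + 1)).norm_image_sub_le_of_norm_fderiv_le (𝕜 := ℝ)
        (fun z _ => differentiable_of_smooth_uncurry hH t z) (fun z hz => ?_) ?_ ?_
      · refine ContinuousLinearMap.opNorm_le_bound _ (by positivity) fun η => ?_
        rw [fderiv_eq_omegaCL_XH (differentiable_of_smooth_uncurry hH t z), Real.norm_eq_abs]
        have h7 : N * (‖z‖ + 1) ≤ N * (R + 2) :=
          mul_le_mul_of_nonneg_left (by linarith [mem_closedBall_zero_iff.1 hz]) hN0
        have h8 := mul_le_mul_of_nonneg_left ((hN t z).trans h7) (norm_nonneg η)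
        linarith [abs_omegaCL_le η (XH (H t) z)]
      · exact mem_closedBall_zero_iff.2 (by linarith [hR t ht])
      · exact mem_closedBall_zero_iff.2 (hyR t ht)
    have h9 : 2 * (N * (R + 2)) * ‖y t - x t‖ ≤ 2 * (N * (R + 2)) * δ := by
      have hR0 : 0 ≤ R := (norm_nonneg _).trans (hR t ht)
      gcongr
      exact hδ t
    rw [Real.norm_eq_abs] at h6
    refine (abs_sub _ _).trans ?_
    rw [abs_mul, abs_of_pos (by norm_num : (0 : ℝ) < 1 / 2)]
    linarith
  have hξ : ∫ t in (0 : ℝ)..1, ‖ξ t‖ ≤ √(∫ t in (0 : ℝ)..1, ‖ξ t‖ ^ 2) := by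
    refine Real.le_sqrt_of_sq_le ?_
    have := sq_intervalIntegral_le (f := fun t => ‖ξ t‖) (by fun_prop) (zero_lt_one' ℝ)
    simpa using this
  calc _ ≤ ∫ t in (0 : ℝ)..1, |(1 / 2) * omegaCL n (y t - x t) (y' t + x' t)
      - (H t (y t) - H t (x t))| := abs_integral_le_integral_abs zero_le_one
    _ ≤ ∫ t in (0 : ℝ)..1, δ * (2 * ‖ξ t‖ + 4 * N * (R + 2)) :=
      integral_mono_on zero_le_one (Continuous.intervalIntegrable (by fun_prop) _ _)
        (Continuous.intervalIntegrable (by fun_prop) _ _) hpt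
    _ = δ * (2 * (∫ t in (0 : ℝ)..1, ‖ξ t‖) + 4 * N * (R + 2)) := by
      rw [intervalIntegral.integral_const_mul,
        integral_add (Continuous.intervalIntegrable (by fun_prop) _ _)
          (Continuous.intervalIntegrable (by fun_prop) _ _),
        intervalIntegral.integral_const_mul, intervalIntegral.integral_const]
      simp
    _ ≤ _ := by gcongr

end Action

section FloerSolutions

variable {n : ℕ} {H : ℝ → P n → ℝ} {J : ℝ → P n → P n →L[ℝ] P n} {xm xp : ℝ → P n}
  {u : ℝ → ℝ → P n}

/-- The map `(s, t) ↦ u s t` on the plane. -/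
def planeMap (u : ℝ → ℝ → P n) (z : ℝ × ℝ) : P n := u z.1 z.2

theorem FloerSol.contDiff_planeMap (hu : FloerSol H J xm xp u) :
    ContDiff ℝ (⊤ : ℕ∞) (planeMap u) := hu.smooth

theorem FloerSol.pdFst_planeMap (hu : FloerSol H J xm xp u) (z : ℝ × ℝ) :
    pdFst (planeMap u) z = J z.2 (planeMap u z) (pdSnd (planeMap u) z
      - XH (H z.2) (planeMap u z)) := by
  obtain ⟨s, t⟩ := z
  rw [← (hasDerivAt_pdFst hu.contDiff_planeMap s t).deriv,
    ← (hasDerivAt_pdSnd hu.contDiff_planeMap s t).deriv]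
  exact hu.eqn s t

theorem FloerSol.pdFst_periodic (hu : FloerSol H J xm xp u) (s t : ℝ) :
    pdFst (planeMap u) (s, t + 1) = pdFst (planeMap u) (s, t) := by
  rw [← (hasDerivAt_pdFst hu.contDiff_planeMap s t).deriv,
    ← (hasDerivAt_pdFst hu.contDiff_planeMap s (t + 1)).deriv]
  simp only [planeMap, hu.periodic]

theorem FloerSol.pdSnd_periodic (hu : FloerSol H J xm xp u) (s t : ℝ) :
    pdSnd (planeMap u) (s, t + 1) = pdSnd (planeMap u) (s, t) := by
  have h1 := (hasDerivAt_pdSnd hu.contDiff_planeMap s (t + 1)).comp_add_const t 1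
  simp only [planeMap, hu.periodic] at h1
  exact h1.unique (hasDerivAt_pdSnd hu.contDiff_planeMap s t)

/-- The action converges at the ends of a Floer solution, up to the dissipation rate. -/
theorem eventually_abs_action_sub_le
    (hH : ContDiff ℝ (⊤ : ℕ∞) (fun z : ℝ × P n => H z.1 z.2)) {N : ℝ}
    (hN : ∀ t z, ‖XH (H t) z‖ ≤ N * (‖z‖ + 1)) {U : ℝ × ℝ → P n} (hU : ContDiff ℝ (⊤ : ℕ∞) U)
    (hper : ∀ s, U (s, 0) = U (s, 1))
    (hUN : ∀ z, ‖pdSnd U z‖ ≤ 2 * ‖pdFst U z‖ + N * (‖U z‖ + 1)) {x : ℝ → P n}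
    (hx : IsPeriodicOrbit H x) {l : Filter ℝ}
    (hl : TendstoUniformly (fun s t => U (s, t)) x l) {η : ℝ} (hη : 0 < η) :
    ∀ᶠ s in l, |((∫ t in (0 : ℝ)..1, (1 / 2) * omegaCL n (U (s, t)) (pdSnd U (s, t)))
        - ∫ t in (0 : ℝ)..1, H t (U (s, t)))
      - ((∫ t in (0 : ℝ)..1, (1 / 2) * omegaCL n (x t) (deriv x t))
        - ∫ t in (0 : ℝ)..1, H t (x t))|
      ≤ η * (1 + √(∫ t in (0 : ℝ)..1, ‖pdFst U (s, t)‖ ^ 2)) := by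
  obtain ⟨R, hR⟩ := (isCompact_Icc (a := (0 : ℝ)) (b := 1)).exists_bound_of_continuousOn
    hx.smooth.continuous.continuousOn
  have hN0 : 0 ≤ N := by simpa using (norm_nonneg _).trans (hN 0 0)
  have hR0 : 0 ≤ R := (norm_nonneg _).trans (hR 0 (by simp))
  set K := 4 * N * (R + 2) + 2 with hK
  have hK0 : 0 < K := by positivity
  set δ := min 1 (η / K) with hδ
  have hδ0 : 0 < δ := by positivity
  have hδK : δ * K ≤ η := by
    rw [← le_div_iff₀ hK0]
    exact min_le_right _ _
  filter_upwards [Metric.tendstoUniformly_iff.1 hl δ hδ0] with s hs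
  have c1 := (contDiff_pdFst hU).continuous
  have c2 := (contDiff_pdSnd hU).continuous
  have h1 := abs_action_sub_le hH hN (x := x) (x' := deriv x) (y := fun t => U (s, t))
    (y' := fun t => pdSnd U (s, t)) (ξ := fun t => pdFst U (s, t)) (R := R) (δ := δ)
    (fun t => ((hx.smooth.differentiable (by simp)) t).hasDerivAt) (hasDerivAt_pdSnd hU s)
    (hx.smooth.continuous_deriv (by simp)) (by fun_prop) (by fun_prop)
    (by simpa using (hx.periodic 0).symm) (hper s) (fun t => by rw [hx.eqn]; exact hN _ _)
    (fun t => hUN _) hR (fun t => by rw [← dist_eq_norm, dist_comm]; exact (hs t).le)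
    (min_le_left _ _)
  refine h1.trans ?_
  set q := √(∫ t in (0 : ℝ)..1, ‖pdFst U (s, t)‖ ^ 2)
  have hq : 0 ≤ q := Real.sqrt_nonneg _
  calc δ * (2 * q + 4 * N * (R + 2)) ≤ δ * (K * (1 + q)) := by
        gcongr
        have : 0 ≤ 4 * N * (R + 2) * q := by positivity
        rw [hK]
        linarith
    _ = δ * K * (1 + q) := by ring
    _ ≤ _ := by gcongr

theorem FloerSol.exists_norm_le (hu : FloerSol H J xm xp u) (cm : Continuous xm)
    (cp : Continuous xp) : ∃ R, ∀ z, ‖planeMap u z‖ ≤ R := by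
  obtain ⟨Rm, hRm⟩ := (isCompact_Icc (a := (0 : ℝ)) (b := 1)).exists_bound_of_continuousOn
    cm.continuousOn
  obtain ⟨Rp, hRp⟩ := (isCompact_Icc (a := (0 : ℝ)) (b := 1)).exists_bound_of_continuousOn
    cp.continuousOn
  obtain ⟨a, ha⟩ := eventually_atBot.1 (Metric.tendstoUniformly_iff.1 hu.tendsto_bot 1 one_pos)
  obtain ⟨b, hb⟩ := eventually_atTop.1 (Metric.tendstoUniformly_iff.1 hu.tendsto_top 1 one_pos)
  obtain ⟨R, hR⟩ := ((isCompact_Icc (a := a) (b := b)).prod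
    (isCompact_Icc (a := (0 : ℝ)) (b := 1))).exists_bound_of_continuousOn
    hu.contDiff_planeMap.continuous.continuousOn
  have key : ∀ s, ∀ t ∈ Icc (0 : ℝ) 1, ‖u s t‖ ≤ max R (max (Rm + 1) (Rp + 1)) := by
    intro s t ht
    rcases le_or_gt s a with h | h
    · have h1 := ha s h t
      rw [dist_comm, dist_eq_norm] at h1
      have h2 := norm_add_le (u s t - xm t) (xm t)
      rw [sub_add_cancel] at h2
      exact le_max_of_le_right (le_max_of_le_left (by linarith [hRm t ht]))
    rcases le_or_gt b s with h' | h'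
    · have h1 := hb s h' t
      rw [dist_comm, dist_eq_norm] at h1
      have h2 := norm_add_le (u s t - xp t) (xp t)
      rw [sub_add_cancel] at h2
      exact le_max_of_le_right (le_max_of_le_right (by linarith [hRp t ht]))
    · exact le_max_of_le_left (hR (s, t) ⟨⟨h.le, h'.le⟩, ht⟩)
  refine ⟨max R (max (Rm + 1) (Rp + 1)), fun z => ?_⟩
  have hp : Function.Periodic (u z.1) 1 := hu.periodic z.1
  have h1 : u z.1 (Int.fract z.2) = u z.1 z.2 := by
    have := hp.sub_int_mul_eq (x := z.2) ⌊z.2⌋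
    rwa [mul_one] at this
  have h2 := key z.1 (Int.fract z.2) ⟨Int.fract_nonneg _, (Int.fract_lt_one _).le⟩
  rw [h1] at h2
  exact h2

end FloerSolutions

section UniformBound

variable {n : ℕ} {H : ℝ → P n → ℝ} {J : ℝ → P n → P n →L[ℝ] P n} {xm xp : ℝ → P n}

/-- The symplectic action of a loop. -/
def action (H : ℝ → P n → ℝ) (x : ℝ → P n) : ℝ :=
  (∫ t in (0 : ℝ)..1, (1 / 2) * omegaCL n (x t) (deriv x t)) - ∫ t in (0 : ℝ)..1, H t (x t)

theorem norm_XH_le {a C : ℝ} (ha : 0 ≤ a)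
    (hC : ∀ t z, ‖XH (H t) z - (2 * a) • Jstd n z‖ ≤ C) (t : ℝ) (z : P n) :
    ‖XH (H t) z‖ ≤ 2 * a * ‖z‖ + C := by
  have h1 := norm_add_le (XH (H t) z - (2 * a) • Jstd n z) ((2 * a) • Jstd n z)
  rw [sub_add_cancel, norm_smul, Real.norm_eq_abs, abs_of_nonneg (by positivity)] at h1
  have h2 : 2 * a * ‖Jstd n z‖ ≤ 2 * a * ‖z‖ := by gcongr; exact norm_Jstd_le z
  linarith [hC t z]

variable (hJ2 : ∀ t z ξ, J t z (J t z ξ) = -ξ) (hJ : ∀ t z, ‖J t z - Jstd n‖ ≤ 1 / 4)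
include hJ2 hJ

theorem FloerSol.norm_pdSnd_sub_le {u : ℝ → ℝ → P n} (hu : FloerSol H J xm xp u) (z : ℝ × ℝ) :
    ‖pdSnd (planeMap u) z - XH (H z.2) (planeMap u z)‖ ≤ 2 * ‖pdFst (planeMap u) z‖ := by
  have h1 := norm_apply_le_of_near_Jstd (hJ z.2 (planeMap u z)) (pdFst (planeMap u) z)
  rw [hu.pdFst_planeMap, hJ2, norm_neg] at h1
  rwa [hu.pdFst_planeMap]

variable (hH : ContDiff ℝ (⊤ : ℕ∞) (fun z : ℝ × P n => H z.1 z.2)) {a C : ℝ} (ha : 0 ≤ a)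
  (hC : ∀ t z, ‖XH (H t) z - (2 * a) • Jstd n z‖ ≤ C)
include hH ha hC

/-- The energy of a Floer solution is bounded by the action difference of its ends. -/
theorem FloerSol.integral_energy_le (hxm : IsPeriodicOrbit H xm) (hxp : IsPeriodicOrbit H xp)
    {u : ℝ → ℝ → P n} (hu : FloerSol H J xm xp u) {s₀ s₁ : ℝ} (hs : s₀ ≤ s₁) :
    ∫ s in s₀..s₁, ∫ t in (0 : ℝ)..1, ‖pdFst (planeMap u) (s, t)‖ ^ 2
      ≤ 2 * (action H xm - action H xp) := by
  set U := planeMap u with hUdef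
  have hU : ContDiff ℝ (⊤ : ℕ∞) U := hu.contDiff_planeMap
  have hC0 : 0 ≤ C := (norm_nonneg _).trans (hC 0 0)
  have hN : ∀ t z, ‖XH (H t) z‖ ≤ (2 * a + C) * (‖z‖ + 1) := fun t z => by
    have := norm_XH_le ha hC t z
    nlinarith [norm_nonneg z]
  have hper : ∀ s, U (s, 0) = U (s, 1) := fun s => by
    have := (hu.periodic s 0).symm
    rwa [zero_add] at this
  have hUN : ∀ z, ‖pdSnd U z‖ ≤ 2 * ‖pdFst U z‖ + (2 * a + C) * (‖U z‖ + 1) := fun z => by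
    have h1 := norm_add_le (pdSnd U z - XH (H z.2) (U z)) (XH (H z.2) (U z))
    rw [sub_add_cancel] at h1
    linarith [hu.norm_pdSnd_sub_le hJ2 hJ z, hN z.2 (U z)]
  have c1 := (contDiff_pdFst hU).continuous
  refine integral_dissipation_le (hasDerivAt_action hH hU hper)
    (continuous_parametric_intervalIntegral_of_continuous' (by fun_prop) _ _)
    (fun s => integral_nonneg zero_le_one fun t _ => by positivity) (fun s => ?_)
    (fun η hη => eventually_abs_action_sub_le hH hN hU hper hUN hxp hu.tendsto_top hη)
    (fun η hη => eventually_abs_action_sub_le hH hN hU hper hUN hxm hu.tendsto_bot hη) hs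
  have hpt : ∀ t, omegaCL n (pdFst U (s, t)) (pdSnd U (s, t) - XH (H t) (U (s, t)))
      = -omegaCL n (pdFst U (s, t)) (J t (U (s, t)) (pdFst U (s, t))) := fun t => by
    have : pdSnd U (s, t) - XH (H t) (U (s, t)) = -J t (U (s, t)) (pdFst U (s, t)) := by
      rw [hu.pdFst_planeMap, hJ2, neg_neg]
    rw [this, map_neg]
  have cX : Continuous fun t => omegaCL n (pdFst U (s, t))
      (pdSnd U (s, t) - XH (H t) (U (s, t))) := by
    have c2 := (contDiff_pdSnd hU).continuous
    have e1 : ∀ t, omegaCL n (pdFst U (s, t)) (XH (H t) (U (s, t)))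
        = fderiv ℝ (fun z : ℝ × P n => H z.1 z.2) (t, U (s, t)) (0, pdFst U (s, t)) := by
      intro t
      rw [← fderiv_eq_omegaCL_XH (differentiable_of_smooth_uncurry hH t _)]
      have h1 := ((hH.differentiable (by simp)) (t, U (s, t))).hasFDerivAt.comp (U (s, t))
        (hasFDerivAt_prodMk_right t (U (s, t)))
      have h2 : fderiv ℝ (H t) (U (s, t)) = _ := h1.fderiv
      rw [h2]
      simp
    simp only [map_sub, e1]
    have c3 := hH.continuous_fderiv (by simp)
    have c4 := hU.continuous
    fun_prop
  rw [← intervalIntegral.integral_const_mul]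
  refine integral_mono_on zero_le_one (cX.intervalIntegrable _ _)
    (Continuous.intervalIntegrable (by fun_prop) _ _) fun t _ => ?_
  rw [hpt]
  linarith [half_sq_norm_le_omegaCL (hJ t (U (s, t))) (pdFst U (s, t))]

/-- Uniform local `H¹` bounds for Floer solutions. -/
theorem exists_local_energy_bound (hcos : Real.cos (2 * a) < 1) (hxm : IsPeriodicOrbit H xm)
    (hxp : IsPeriodicOrbit H xp) :
    ∃ D, ∀ u : ℝ → ℝ → P n, FloerSol H J xm xp u → ∀ s₀ t₀ : ℝ,
      ∫ s in (s₀ - 1)..(s₀ + 1), ∫ t in (t₀ - 1)..(t₀ + 1),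
        (‖planeMap u (s, t)‖ ^ 2 + ‖pdFst (planeMap u) (s, t)‖ ^ 2
          + ‖pdSnd (planeMap u) (s, t)‖ ^ 2) ≤ D := by
  obtain ⟨M, hM, hloop⟩ := exists_loop_bound (n := n) hcos C
  refine ⟨2 * (M * (2 + 2 * (action H xm - action H xp))), fun u hu s₀ t₀ => ?_⟩
  set U := planeMap u with hUdef
  have hU : ContDiff ℝ (⊤ : ℕ∞) U := hu.contDiff_planeMap
  have c0 := hU.continuous
  have c1 := (contDiff_pdFst hU).continuous
  have c2 := (contDiff_pdSnd hU).continuous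
  set G : ℝ × ℝ → ℝ := fun z => ‖U z‖ ^ 2 + ‖pdFst U z‖ ^ 2 + ‖pdSnd U z‖ ^ 2 with hG
  have cG : Continuous G := by fun_prop
  have hper : ∀ s t, U (s, t + 1) = U (s, t) := hu.periodic
  set e : ℝ → ℝ := fun s => ∫ t in (0 : ℝ)..1, ‖pdFst U (s, t)‖ ^ 2 with he
  have ce : Continuous e :=
    continuous_parametric_intervalIntegral_of_continuous' (by fun_prop) _ _
  have hslice : ∀ s, ∫ t in (0 : ℝ)..1, G (s, t) ≤ M * (1 + e s) := by
    intro s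
    refine hloop (fun t => U (s, t)) (fun t => pdSnd U (s, t)) (fun t => pdFst U (s, t))
      (hasDerivAt_pdSnd hU s) (by fun_prop) (by fun_prop) (hper s) fun t => ?_
    have h1 := norm_add_le (pdSnd U (s, t) - XH (H t) (U (s, t)))
      (XH (H t) (U (s, t)) - (2 * a) • Jstd n (U (s, t)))
    rw [sub_add_sub_cancel] at h1
    linarith [hu.norm_pdSnd_sub_le hJ2 hJ (s, t), hC t (U (s, t))]
  have htwo : ∀ s, ∫ t in (t₀ - 1)..(t₀ + 1), G (s, t) = 2 * ∫ t in (0 : ℝ)..1, G (s, t) := by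
    intro s
    have hp : Function.Periodic (fun t => G (s, t)) 1 := fun t => by
      simp only [hG]
      rw [hper, hu.pdFst_periodic, hu.pdSnd_periodic]
    have i : ∀ x y, IntervalIntegrable (fun t => G (s, t)) volume x y := fun x y =>
      Continuous.intervalIntegrable (by fun_prop) _ _
    have h1 := hp.intervalIntegral_add_eq (t₀ - 1) 0
    have h2 := hp.intervalIntegral_add_eq t₀ 0
    rw [sub_add_cancel] at h1
    rw [zero_add] at h1 h2
    rw [← integral_add_adjacent_intervals (i _ t₀) (i _ _), h1, h2, two_mul]
  calc ∫ s in (s₀ - 1)..(s₀ + 1), ∫ t in (t₀ - 1)..(t₀ + 1), G (s, t)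
      = ∫ s in (s₀ - 1)..(s₀ + 1), 2 * ∫ t in (0 : ℝ)..1, G (s, t) := by simp only [htwo]
    _ ≤ ∫ s in (s₀ - 1)..(s₀ + 1), 2 * (M * (1 + e s)) := by
        refine integral_mono_on (by linarith) (Continuous.intervalIntegrable ?_ _ _)
          (Continuous.intervalIntegrable (by fun_prop) _ _) fun s _ => by linarith [hslice s]
        exact (continuous_parametric_intervalIntegral_of_continuous' (by fun_prop) _ _).const_mul 2
    _ = 2 * (M * (2 + ∫ s in (s₀ - 1)..(s₀ + 1), e s)) := by
        rw [intervalIntegral.integral_const_mul, intervalIntegral.integral_const_mul,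
          integral_add (Continuous.intervalIntegrable (by fun_prop) _ _)
            (ce.intervalIntegrable _ _), intervalIntegral.integral_const, smul_eq_mul]
        ring
    _ ≤ _ := by
        gcongr
        exact hu.integral_energy_le hJ2 hJ hH ha hC hxm hxp (by linarith)

/-- Uniform `C⁰` bounds for Floer solutions. -/
theorem exists_floerSol_bound (hcos : Real.cos (2 * a) < 1) (hxm : IsPeriodicOrbit H xm)
    (hxp : IsPeriodicOrbit H xp) :
    ∃ R, ∀ u : ℝ → ℝ → P n, FloerSol H J xm xp u → ∀ z, ‖planeMap u z‖ ≤ R := by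
  obtain ⟨D, hD⟩ := exists_local_energy_bound hJ2 hJ hH ha hC hcos hxm hxp
  set ρ := 1 / (4800 * (a + 1)) with hρdef
  have hρ : 0 < ρ := by positivity
  have hρa : 4800 * a * ρ + 4800 * ρ = 1 := by rw [hρdef]; field_simp
  have haρ : 0 ≤ a * ρ := by positivity
  set K := √D / ρ + 200 * (3 * √D + 6 * C * ρ + ρ) with hK
  refine ⟨2 * K, fun u hu => ?_⟩
  obtain ⟨B, hB⟩ := hu.exists_norm_le hxm.smooth.continuous hxp.smooth.continuous
  have hbdd : BddAbove (range fun z => ‖planeMap u z‖) := ⟨B, forall_mem_range.2 hB⟩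
  set S := ⨆ z, ‖planeMap u z‖ with hS
  have hle : ∀ z, ‖planeMap u z‖ ≤ S := fun z => le_ciSup hbdd z
  have hS0 : 0 ≤ S := (norm_nonneg _).trans (hle 0)
  have hstep : S ≤ K + S / 2 := by
    refine ciSup_le fun z => ?_
    have h1 := norm_le_of_local_energy (s₀ := z.1) (t₀ := z.2) (ρ := ρ) omegaCL_skew
      abs_omegaCL_le hu.contDiff_planeMap
      (J := fun z => J z.2 (planeMap u z)) (fun z => hJ2 _ _)
      (fun z => half_sq_norm_le_omegaCL (hJ _ _)) (fun z => norm_apply_le_of_near_Jstd (hJ _ _))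
      (X := fun z => XH (H z.2) (planeMap u z)) (N := 2 * a * S + C)
      (fun z => (norm_XH_le ha hC _ _).trans (by gcongr; exact hle z))
      hu.pdFst_planeMap hρ (by nlinarith) (hD u hu z.1 z.2)
    have h2 : 2400 * (a * ρ) * S ≤ 1 / 2 * S := by
      gcongr
      linarith
    change ‖planeMap u z‖ ≤ _ at h1
    rw [hK]
    linarith
  intro z
  linarith [hle z]

end UniformBound

end CZeroBound

/-- Lemma 2.2: there is `ε > 0` such that for every admissible `H`
and every smooth 1-periodic family `J` of `ω_n`-compatible almost complex structures
with `sup_t ‖J_t − J_std‖_{C⁰} < ε`, the moduli space `ℳ_{H,J}(x₋, x₊)` is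
`C⁰`-bounded for all `x₋, x₊ ∈ 𝒫(H)`. -/
theorem stmt0 (n : ℕ) :
    ∃ ε > (0 : ℝ),
      ∀ H : ℝ → P n → ℝ, Admissible H →
      ∀ J : ℝ → P n → P n →L[ℝ] P n,
        ContDiff ℝ (⊤ : ℕ∞) (fun z : ℝ × P n => J z.1 z.2) →
        (∀ t z, J (t + 1) z = J t z) →
        (∀ t z ξ, J t z (J t z ξ) = -ξ) →
        (∀ t z, Compatible (J t z)) →
        (∃ δ, δ < ε ∧ ∀ t z, ‖J t z - Jstd n‖ ≤ δ) →
        ∀ xm xp : ℝ → P n, IsPeriodicOrbit H xm → IsPeriodicOrbit H xp →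
        ∃ R > (0 : ℝ), ∀ u : ℝ → ℝ → P n, FloerSol H J xm xp u →
          ∀ s t, ‖u s t‖ ≤ R := by
  refine ⟨1 / 4, by norm_num, ?_⟩
  rintro H hH J - - hJ2 - ⟨δ, hδ, hJ⟩ xm xp hxm hxp
  obtain ⟨a, ha, hres, C, hC⟩ := hH.h1
  obtain ⟨R, hR⟩ := exists_floerSol_bound hJ2 (fun t z => (hJ t z).trans hδ.le) hH.smooth ha.le
    (fun t => norm_XH_sub_le (differentiable_of_smooth_uncurry hH.smooth t)
      fun z => (hC t z).2) (cos_two_mul_lt_one hres) hxm hxp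
  exact ⟨max R 1, by positivity, fun u hu s t => (hR u hu (s, t)).trans (le_max_left _ _)⟩

end
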